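/- There exist absolute constants C > 0 and γ₀ > 0 such that for every γ > γ₀ and every unidirectional Stokes wave solution (ψ, η, r) with R(s_c) < r ≤ R(0), the amplitude satisfies η̂ − η̌ ≤ C·γ⁻²; in particular all such waves have small amplitude when the adverse vorticity γ is large. -/

import Mathlib

noncomputable section

open Real Set

/-- Partial derivative of `ψ` in the horizontal variable. -/
def px (ψ : ℝ → ℝ → ℝ) (x y : ℝ) : ℝ := deriv (fun t => ψ t y) x

/-- Partial derivative of `ψ` in the vertical variable. -/
def py (ψ : ℝ → ℝ → ℝ) (x y : ℝ) : ℝ := deriv (fun t => ψ x t) y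

/-- Second partial derivative in `x`. -/
def pxx (ψ : ℝ → ℝ → ℝ) (x y : ℝ) : ℝ := deriv (fun t => px ψ t y) x

/-- Second partial derivative in `y`. -/
def pyy (ψ : ℝ → ℝ → ℝ) (x y : ℝ) : ℝ := deriv (fun t => py ψ x t) y

/-- Depth `d(s)` of the laminar (stream) flow with surface value `s` of `ψ_y`. -/
def lamDepth (γ s : ℝ) : ℝ := (-s + Real.sqrt (s ^ 2 + 2 * γ)) / γ

/-- Bernoulli constant `R(s) = ½ s² + γ + d(s)` of the laminar flow. -/
def bernR (γ s : ℝ) : ℝ := s ^ 2 / 2 + γ + lamDepth γ s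

/-- `s` is the (unique) positive critical point `s_c` of `R`, characterized by the
equation `s - 1/γ + s/(γ √(s² + 2γ)) = 0`. -/
def IsCrit (γ s : ℝ) : Prop :=
  0 < s ∧ s - 1 / γ + s / (γ * Real.sqrt (s ^ 2 + 2 * γ)) = 0

/-- A solution `(ψ, η, r)` of the stream-function formulation with constant adverse
vorticity `ω = -γ`:  `Δψ = γ` in the fluid domain `D_η`, the Bernoulli condition on the
surface, `ψ = 1` on the surface and `ψ = 0` on the flat bottom. -/
structure StreamSolution (γ : ℝ) (ψ : ℝ → ℝ → ℝ) (η : ℝ → ℝ) (r : ℝ) : Prop where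
  eta_smooth : ContDiff ℝ (⊤ : ℕ∞) η
  eta_pos : ∀ x, 0 < η x
  psi_smooth : ContDiff ℝ (⊤ : ℕ∞) (fun p : ℝ × ℝ => ψ p.1 p.2)
  laplace : ∀ x y, 0 < y → y < η x → pxx ψ x y + pyy ψ x y = γ
  bernoulli : ∀ x, (px ψ x (η x)) ^ 2 / 2 + (py ψ x (η x)) ^ 2 / 2 + η x = r
  surface_val : ∀ x, ψ x (η x) = 1
  bottom_val : ∀ x, ψ x 0 = 0

/-- The flow is unidirectional: `ψ_y > 0` everywhere in the fluid domain `D_η`. -/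
def Unidirectional (ψ : ℝ → ℝ → ℝ) (η : ℝ → ℝ) : Prop :=
  ∀ x y, 0 < y → y < η x → 0 < py ψ x y

/-- A Stokes wave with half-period `Λ`: the solution is `2Λ`-periodic and even in `x`,
and the surface profile is strictly decreasing from the crest (`x = 0`) to the
trough (`x = Λ`).  Thus `η̂ = max η = η 0` and `η̌ = min η = η Λ`. -/
structure StokesWave (γ : ℝ) (ψ : ℝ → ℝ → ℝ) (η : ℝ → ℝ) (r Λ : ℝ) : Prop where
  sol : StreamSolution γ ψ η r
  lam_pos : 0 < Λ
  eta_periodic : ∀ x, η (x + 2 * Λ) = η x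
  eta_even : ∀ x, η (-x) = η x
  psi_periodic : ∀ x y, ψ (x + 2 * Λ) y = ψ x y
  psi_even : ∀ x y, ψ (-x) y = ψ x y
  eta_anti : StrictAntiOn η (Set.Icc 0 Λ)

/-- A solitary wave (relative to the critical value `sc = s_c` of `γ`): the solution is
even in `x`, the profile is strictly decreasing on `(0, ∞)` and non-constant, and the
flow converges to a supercritical laminar flow `(U(·; s), d(s))` with `s > s_c`,
`R(s) = r` as `|x| → ∞`.  The crest is at `x = 0`, `η̂ = η 0` and `η̌ = inf η = d(s)`. -/
structure SolitaryWave (γ sc : ℝ) (ψ : ℝ → ℝ → ℝ) (η : ℝ → ℝ) (r : ℝ) : Prop where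
  sol : StreamSolution γ ψ η r
  eta_even : ∀ x, η (-x) = η x
  psi_even : ∀ x y, ψ (-x) y = ψ x y
  eta_anti : StrictAntiOn η (Set.Ioi 0)
  nonconst : ∃ x₁ x₂, η x₁ ≠ η x₂
  asymptotic : ∃ s, sc < s ∧ bernR γ s = r ∧
    ∀ ε > 0, ∃ X : ℝ, ∀ x : ℝ, X ≤ |x| →
      |η x - lamDepth γ s| ≤ ε ∧
      ∀ y ∈ Set.Icc 0 (η x), |px ψ x y| + |py ψ x y - (γ * y + s)| ≤ ε


/-! ### Smooth functions of two variables -/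

def Sm (φ : ℝ → ℝ → ℝ) : Prop := ContDiff ℝ (⊤ : ℕ∞) (fun p : ℝ × ℝ => φ p.1 p.2)

lemma Sm.diff {φ : ℝ → ℝ → ℝ} (h : Sm φ) (p : ℝ × ℝ) :
    DifferentiableAt ℝ (fun p : ℝ × ℝ => φ p.1 p.2) p :=
  (ContDiff.differentiable h (by simp)) p

lemma Sm.hasx' {φ : ℝ → ℝ → ℝ} (h : Sm φ) (x y : ℝ) :
    HasDerivAt (fun t => φ t y) (fderiv ℝ (fun p : ℝ × ℝ => φ p.1 p.2) (x, y) (1, 0)) x := by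
  have h1 := (h.diff (x, y)).hasFDerivAt
  have h2 : HasDerivAt (fun t : ℝ => (t, y)) ((1 : ℝ), (0 : ℝ)) x :=
    (hasDerivAt_id x).prodMk (hasDerivAt_const x y)
  exact HasFDerivAt.comp_hasDerivAt (f := fun t : ℝ => (t, y)) x h1 h2

lemma Sm.hasy' {φ : ℝ → ℝ → ℝ} (h : Sm φ) (x y : ℝ) :
    HasDerivAt (fun t => φ x t) (fderiv ℝ (fun p : ℝ × ℝ => φ p.1 p.2) (x, y) (0, 1)) y := by
  have h1 := (h.diff (x, y)).hasFDerivAt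
  have h2 : HasDerivAt (fun t : ℝ => (x, t)) ((0 : ℝ), (1 : ℝ)) y :=
    (hasDerivAt_const y x).prodMk (hasDerivAt_id y)
  exact HasFDerivAt.comp_hasDerivAt (f := fun t : ℝ => (x, t)) y h1 h2

lemma Sm.px_eq {φ : ℝ → ℝ → ℝ} (h : Sm φ) (x y : ℝ) :
    px φ x y = fderiv ℝ (fun p : ℝ × ℝ => φ p.1 p.2) (x, y) (1, 0) := (h.hasx' x y).deriv

lemma Sm.py_eq {φ : ℝ → ℝ → ℝ} (h : Sm φ) (x y : ℝ) :
    py φ x y = fderiv ℝ (fun p : ℝ × ℝ => φ p.1 p.2) (x, y) (0, 1) := (h.hasy' x y).deriv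

lemma Sm.hasx {φ : ℝ → ℝ → ℝ} (h : Sm φ) (x y : ℝ) :
    HasDerivAt (fun t => φ t y) (px φ x y) x := by
  rw [h.px_eq]; exact h.hasx' x y

lemma Sm.hasy {φ : ℝ → ℝ → ℝ} (h : Sm φ) (x y : ℝ) :
    HasDerivAt (fun t => φ x t) (py φ x y) y := by
  rw [h.py_eq]; exact h.hasy' x y

lemma Sm.fd {φ : ℝ → ℝ → ℝ} (h : Sm φ) :
    ContDiff ℝ (⊤ : ℕ∞) (fderiv ℝ (fun p : ℝ × ℝ => φ p.1 p.2)) :=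
  ContDiff.fderiv_right (m := (⊤ : ℕ∞)) h (by simp)

lemma Sm.px {φ : ℝ → ℝ → ℝ} (h : Sm φ) : Sm (px φ) := by
  have : (fun p : ℝ × ℝ => _root_.px φ p.1 p.2) =
      fun p => fderiv ℝ (fun p : ℝ × ℝ => φ p.1 p.2) p (1, 0) := by
    funext p; rw [h.px_eq]
  unfold Sm; rw [this]
  exact h.fd.clm_apply contDiff_const

lemma Sm.py {φ : ℝ → ℝ → ℝ} (h : Sm φ) : Sm (py φ) := by
  have : (fun p : ℝ × ℝ => _root_.py φ p.1 p.2) =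
      fun p => fderiv ℝ (fun p : ℝ × ℝ => φ p.1 p.2) p (0, 1) := by
    funext p; rw [h.py_eq]
  unfold Sm; rw [this]
  exact h.fd.clm_apply contDiff_const

lemma Sm.comm {φ : ℝ → ℝ → ℝ} (h : Sm φ) : _root_.px (_root_.py φ) = _root_.py (_root_.px φ) := by
  funext x y
  rw [h.py.px_eq, h.px.py_eq]
  have e1 : (fun p : ℝ × ℝ => _root_.px φ p.1 p.2) =
      fun p => fderiv ℝ (fun p : ℝ × ℝ => φ p.1 p.2) p (1, 0) := by
    funext p; rw [h.px_eq]
  have e2 : (fun p : ℝ × ℝ => _root_.py φ p.1 p.2) =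
      fun p => fderiv ℝ (fun p : ℝ × ℝ => φ p.1 p.2) p (0, 1) := by
    funext p; rw [h.py_eq]
  rw [e1, e2]
  have hd : DifferentiableAt ℝ (fderiv ℝ (fun p : ℝ × ℝ => φ p.1 p.2)) (x, y) :=
    (h.fd.differentiable (by simp)) _
  have f1 : ∀ v : ℝ × ℝ, fderiv ℝ (fun p => fderiv ℝ (fun p : ℝ × ℝ => φ p.1 p.2) p v) (x, y)
      = (fderiv ℝ (fderiv ℝ (fun p : ℝ × ℝ => φ p.1 p.2)) (x, y)).flip v := by
    intro v
    rw [fderiv_clm_apply hd (differentiableAt_const v)]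
    simp
  rw [f1, f1]
  have hs : IsSymmSndFDerivAt ℝ (fun p : ℝ × ℝ => φ p.1 p.2) (x, y) := by
    apply ContDiffAt.isSymmSndFDerivAt (n := (⊤ : ℕ∞))
    · exact ContDiff.contDiffAt h
    · simp only [minSmoothness_of_isRCLikeNormedField]
      exact WithTop.coe_le_coe.2 (le_top : (2 : ℕ∞) ≤ ⊤)
  exact hs _ _

lemma Sm.cont {φ : ℝ → ℝ → ℝ} (h : Sm φ) : Continuous (fun p : ℝ × ℝ => φ p.1 p.2) :=
  ContDiff.continuous h

lemma Sm.curve {φ : ℝ → ℝ → ℝ} (h : Sm φ) {η : ℝ → ℝ} {x d : ℝ} (hη : HasDerivAt η d x) :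
    HasDerivAt (fun t => φ t (η t)) (_root_.px φ x (η x) + d * _root_.py φ x (η x)) x := by
  have h1 := (h.diff (x, η x)).hasFDerivAt
  have h2 : HasDerivAt (fun t : ℝ => (t, η t)) ((1 : ℝ), d) x := (hasDerivAt_id x).prodMk hη
  have h3 := HasFDerivAt.comp_hasDerivAt (f := fun t : ℝ => (t, η t)) x h1 h2
  rw [h.px_eq, h.py_eq]
  have : ((1 : ℝ), d) = (1, 0) + d • ((0 : ℝ), (1 : ℝ)) := by simp
  rw [this, map_add, map_smul, smul_eq_mul] at h3
  exact h3

lemma second_max {f f' : ℝ → ℝ} {a c : ℝ} (hf : ∀ t, HasDerivAt f (f' t) t)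
    (hf' : HasDerivAt f' c a) (hm : IsLocalMax f a) : c ≤ 0 := by
  by_contra hc
  push Not at hc
  have hz : f' a = 0 := hm.hasDerivAt_eq_zero (hf a)
  have hd : deriv f = f' := by funext t; exact (hf t).deriv
  have hmin : IsLocalMin f a := by
    apply isLocalMin_of_deriv_deriv_pos
    · rw [hd, hf'.deriv]; exact hc
    · rw [hd, hz]
    · exact (hf a).continuousAt
  have heq : f =ᶠ[nhds a] fun _ => f a := by
    filter_upwards [hmin, hm] with t h1 h2
    exact le_antisymm h2 h1
  have h3 : f' =ᶠ[nhds a] fun _ => 0 := by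
    have := heq.deriv
    rw [hd] at this
    simpa using this
  have h4 : HasDerivAt f' 0 a := (hasDerivAt_const a (0 : ℝ)).congr_of_eventuallyEq h3
  have := hf'.unique h4
  linarith

lemma locmax {φ : ℝ → ℝ → ℝ} (h : Sm φ) {x y : ℝ}
    (hm : IsLocalMax (fun p : ℝ × ℝ => φ p.1 p.2) (x, y)) :
    px φ x y = 0 ∧ py φ x y = 0 ∧ px (px φ) x y ≤ 0 ∧ py (py φ) x y ≤ 0 := by
  have m1 : IsLocalMax (fun t => φ t y) x := by
    have hc : ContinuousAt (fun t : ℝ => (t, y)) x := by fun_prop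
    exact hc.eventually hm
  have m2 : IsLocalMax (fun t => φ x t) y := by
    have hc : ContinuousAt (fun t : ℝ => (x, t)) y := by fun_prop
    exact hc.eventually hm
  refine ⟨m1.hasDerivAt_eq_zero (h.hasx x y), m2.hasDerivAt_eq_zero (h.hasy x y), ?_, ?_⟩
  · exact second_max (fun t => h.hasx t y) (h.px.hasx x y) m1
  · exact second_max (fun t => h.hasy x t) (h.py.hasy x y) m2

lemma Sm.neg {φ : ℝ → ℝ → ℝ} (h : Sm φ) : Sm (fun x y => - φ x y) := ContDiff.neg h

lemma px_neg (φ : ℝ → ℝ → ℝ) : px (fun x y => - φ x y) = fun x y => - px φ x y := by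
  funext x y; simp [px]

lemma py_neg (φ : ℝ → ℝ → ℝ) : py (fun x y => - φ x y) = fun x y => - py φ x y := by
  funext x y; simp [py]

lemma locmin {φ : ℝ → ℝ → ℝ} (h : Sm φ) {x y : ℝ}
    (hm : IsLocalMin (fun p : ℝ × ℝ => φ p.1 p.2) (x, y)) :
    px φ x y = 0 ∧ py φ x y = 0 ∧ 0 ≤ px (px φ) x y ∧ 0 ≤ py (py φ) x y := by
  have := locmax h.neg hm.neg
  simp only [px_neg, py_neg] at this
  obtain ⟨a, b, c, d⟩ := this
  exact ⟨by linarith, by linarith, by linarith, by linarith⟩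

lemma deriv_right_nonpos {f : ℝ → ℝ} {c a : ℝ} (h : HasDerivAt f c a)
    (hm : ∀ᶠ y in nhdsWithin a (Ioi a), f y ≤ f a) : c ≤ 0 := by
  have h1 := (hasDerivAt_iff_tendsto_slope.1 h).mono_left
    (nhdsWithin_mono a (show Ioi a ⊆ {a}ᶜ from fun y hy => (ne_of_gt hy : y ≠ a)))
  refine le_of_tendsto h1 ?_
  filter_upwards [hm, self_mem_nhdsWithin] with y hy hy2
  rw [slope_def_field]
  exact div_nonpos_of_nonpos_of_nonneg (by linarith) (by have : a < y := hy2; linarith)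

lemma deriv_left_nonpos {f : ℝ → ℝ} {c a : ℝ} (h : HasDerivAt f c a)
    (hm : ∀ᶠ y in nhdsWithin a (Iio a), f a ≤ f y) : c ≤ 0 := by
  have h1 := (hasDerivAt_iff_tendsto_slope.1 h).mono_left
    (nhdsWithin_mono a (show Iio a ⊆ {a}ᶜ from fun y hy => (ne_of_lt hy : y ≠ a)))
  refine le_of_tendsto h1 ?_
  filter_upwards [hm, self_mem_nhdsWithin] with y hy hy2
  rw [slope_def_field]
  exact div_nonpos_of_nonneg_of_nonpos (by linarith) (by have : y < a := hy2; linarith)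

/-- Maximum over a periodic closed region `0 ≤ y ≤ τ x`. -/
lemma exists_max_periodic {f : ℝ → ℝ → ℝ} {τ : ℝ → ℝ} {L : ℝ} (hL : 0 < L)
    (hf : Continuous (fun p : ℝ × ℝ => f p.1 p.2)) (hτ : Continuous τ)
    (hfp : ∀ x y, f (x + L) y = f x y) (hτp : ∀ x, τ (x + L) = τ x) (hpos : ∀ x, 0 ≤ τ x) :
    ∃ x₀ y₀, 0 ≤ y₀ ∧ y₀ ≤ τ x₀ ∧ ∀ x y, 0 ≤ y → y ≤ τ x → f x y ≤ f x₀ y₀ := by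
  obtain ⟨B, hB⟩ := (isCompact_Icc (a := (0 : ℝ)) (b := L)).bddAbove_image hτ.continuousOn
  have hK : IsCompact ((Icc (0 : ℝ) L ×ˢ Icc (0 : ℝ) B) ∩ {p : ℝ × ℝ | p.2 ≤ τ p.1}) := by
    apply (isCompact_Icc.prod isCompact_Icc).inter_right
    exact isClosed_le continuous_snd (hτ.comp continuous_fst)
  have hle : ∀ x ∈ Icc 0 L, τ x ≤ B := fun x hx => hB ⟨x, hx, rfl⟩
  have hne : ((Icc (0 : ℝ) L ×ˢ Icc (0 : ℝ) B) ∩ {p : ℝ × ℝ | p.2 ≤ τ p.1}).Nonempty :=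
    ⟨(0, 0), ⟨⟨⟨le_refl _, hL.le⟩, ⟨le_refl _, (hpos 0).trans (hle 0 ⟨le_refl _, hL.le⟩)⟩⟩, hpos 0⟩⟩
  obtain ⟨⟨x₀, y₀⟩, ⟨hp, hp2⟩, hmax⟩ := hK.exists_isMaxOn hne hf.continuousOn
  refine ⟨x₀, y₀, hp.2.1, hp2, ?_⟩
  intro x y hy0 hy1
  have hper : Function.Periodic (fun x => (f x, τ x)) L := by
    intro x
    refine Prod.ext ?_ (hτp x)
    funext y; exact hfp x y
  obtain ⟨x', hx', he⟩ := hper.exists_mem_Ico₀ hL x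
  have e1 : f x = f x' := congrArg Prod.fst he
  have e2 : τ x = τ x' := congrArg Prod.snd he
  rw [e1]
  rw [e2] at hy1
  have hx'' : x' ∈ Icc 0 L := ⟨hx'.1, hx'.2.le⟩
  exact hmax (a := (x', y)) ⟨⟨hx'', ⟨hy0, hy1.trans (hle _ hx'')⟩⟩, hy1⟩


/-! ### Basic properties of Stokes waves -/

section basic

variable {γ : ℝ} {ψ : ℝ → ℝ → ℝ} {η : ℝ → ℝ} {r Λ : ℝ}

lemma closure_nonneg {g : ℝ → ℝ} (hg : Continuous g) {e : ℝ} (he : 0 < e)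
    (h : ∀ y, 0 < y → y < e → 0 ≤ g y) : ∀ y, 0 ≤ y → y ≤ e → 0 ≤ g y := by
  intro y h0 h1
  have hs : closure (Ioo 0 e) ⊆ {y | 0 ≤ g y} :=
    closure_minimal (fun y hy => h y hy.1 hy.2) (isClosed_le continuous_const hg)
  rw [closure_Ioo he.ne] at hs
  exact hs ⟨h0, h1⟩

lemma Sm.conty {φ : ℝ → ℝ → ℝ} (h : Sm φ) (x : ℝ) : Continuous (fun y => φ x y) :=
  h.cont.comp (by fun_prop : Continuous fun y : ℝ => (x, y))

lemma Sm.contx {φ : ℝ → ℝ → ℝ} (h : Sm φ) (y : ℝ) : Continuous (fun x => φ x y) :=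
  h.cont.comp (by fun_prop : Continuous fun x : ℝ => (x, y))

lemma StokesWave.sm (hw : StokesWave γ ψ η r Λ) : Sm ψ := hw.sol.psi_smooth

lemma StokesWave.etac (hw : StokesWave γ ψ η r Λ) : Continuous η := hw.sol.eta_smooth.continuous

lemma StokesWave.etad (hw : StokesWave γ ψ η r Λ) (x : ℝ) : HasDerivAt η (deriv η x) x :=
  ((hw.sol.eta_smooth.differentiable (by simp)) x).hasDerivAt

lemma StokesWave.eta_abs (hw : StokesWave γ ψ η r Λ) (x : ℝ) : η x = η |x| := by
  rcases abs_choice x with h | h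
  · rw [h]
  · rw [h, hw.eta_even]

lemma StokesWave.eta_rep (hw : StokesWave γ ψ η r Λ) (x : ℝ) : ∃ x' ∈ Icc 0 Λ, η x = η x' := by
  have hp : Function.Periodic η (2 * Λ) := hw.eta_periodic
  obtain ⟨y, hy, he⟩ := hp.exists_mem_Ico (by linarith [hw.lam_pos]) x (-Λ)
  refine ⟨|y|, ⟨abs_nonneg y, abs_le.2 ⟨hy.1, by linarith [hy.2]⟩⟩, ?_⟩
  rw [he, hw.eta_abs y]

lemma StokesWave.eta_ge (hw : StokesWave γ ψ η r Λ) (x : ℝ) : η Λ ≤ η x := by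
  obtain ⟨x', hx', he⟩ := hw.eta_rep x
  rw [he]
  exact hw.eta_anti.antitoneOn hx' ⟨hw.lam_pos.le, le_refl _⟩ hx'.2

lemma StokesWave.eta_le (hw : StokesWave γ ψ η r Λ) (x : ℝ) : η x ≤ η 0 := by
  obtain ⟨x', hx', he⟩ := hw.eta_rep x
  rw [he]
  exact hw.eta_anti.antitoneOn ⟨le_refl _, hw.lam_pos.le⟩ hx' hx'.1

lemma StokesWave.eta_ge_of_abs_le (hw : StokesWave γ ψ η r Λ) {b x : ℝ} (hx : |x| ≤ b) :
    η (min b Λ) ≤ η x := by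
  rcases le_total b Λ with h | h
  · rw [min_eq_left h, hw.eta_abs x]
    exact hw.eta_anti.antitoneOn ⟨abs_nonneg x, hx.trans h⟩ ⟨(abs_nonneg x).trans hx, h⟩ hx
  · rw [min_eq_right h]; exact hw.eta_ge x

lemma StokesWave.py_nonneg (hw : StokesWave γ ψ η r Λ) (hu : Unidirectional ψ η) {x y : ℝ}
    (h0 : 0 ≤ y) (h1 : y ≤ η x) : 0 ≤ py ψ x y :=
  closure_nonneg (hw.sm.py.conty x) (hw.sol.eta_pos x) (fun y a b => (hu x y a b).le) y h0 h1

lemma StokesWave.psi_strictMono (hw : StokesWave γ ψ η r Λ) (hu : Unidirectional ψ η) (x : ℝ) :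
    StrictMonoOn (fun y => ψ x y) (Icc 0 (η x)) := by
  apply strictMonoOn_of_deriv_pos (convex_Icc _ _) (hw.sm.conty x).continuousOn
  intro y hy
  rw [interior_Icc] at hy
  exact hu x y hy.1 hy.2

lemma StokesWave.psi_nonneg (hw : StokesWave γ ψ η r Λ) (hu : Unidirectional ψ η) {x y : ℝ}
    (h0 : 0 ≤ y) (h1 : y ≤ η x) : 0 ≤ ψ x y := by
  have := (hw.psi_strictMono hu x).monotoneOn ⟨le_refl 0, (hw.sol.eta_pos x).le⟩ ⟨h0, h1⟩ h0
  simpa [hw.sol.bottom_val] using this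

lemma StokesWave.psi_pos (hw : StokesWave γ ψ η r Λ) (hu : Unidirectional ψ η) {x y : ℝ}
    (h0 : 0 < y) (h1 : y ≤ η x) : 0 < ψ x y := by
  have := (hw.psi_strictMono hu x) ⟨le_refl 0, (hw.sol.eta_pos x).le⟩ ⟨h0.le, h1⟩ h0
  simpa [hw.sol.bottom_val] using this

lemma StokesWave.psi_le_one (hw : StokesWave γ ψ η r Λ) (hu : Unidirectional ψ η) {x y : ℝ}
    (h0 : 0 ≤ y) (h1 : y ≤ η x) : ψ x y ≤ 1 := by
  have := (hw.psi_strictMono hu x).monotoneOn ⟨h0, h1⟩ ⟨(hw.sol.eta_pos x).le, le_refl _⟩ h1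
  simpa [hw.sol.surface_val] using this

lemma StokesWave.lap (hw : StokesWave γ ψ η r Λ) {x y : ℝ}
    (h0 : 0 ≤ y) (h1 : y ≤ η x) : px (px ψ) x y + py (py ψ) x y = γ := by
  have c : Continuous fun y => px (px ψ) x y + py (py ψ) x y :=
    (hw.sm.px.px.conty x).add (hw.sm.py.py.conty x)
  have e : ∀ y, 0 < y → y < η x → px (px ψ) x y + py (py ψ) x y = γ :=
    fun y a b => hw.sol.laplace x y a b
  have a1 := closure_nonneg (c.sub continuous_const) (hw.sol.eta_pos x)
    (fun y a b => (sub_nonneg.2 (e y a b).ge)) y h0 h1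
  have a2 := closure_nonneg ((continuous_const (y := γ)).sub c) (hw.sol.eta_pos x)
    (fun y a b => (sub_nonneg.2 (e y a b).le)) y h0 h1
  simp only [Pi.sub_apply] at a1 a2
  linarith

lemma StokesWave.nhds_dom (hw : StokesWave γ ψ η r Λ) {x y : ℝ}
    (h0 : 0 < y) (h1 : y < η x) : ∀ᶠ p : ℝ × ℝ in nhds (x, y), 0 < p.2 ∧ p.2 < η p.1 := by
  have o : IsOpen {p : ℝ × ℝ | 0 < p.2 ∧ p.2 < η p.1} :=
    (isOpen_lt continuous_const continuous_snd).inter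
      (isOpen_lt continuous_snd (hw.etac.comp continuous_fst))
  exact o.mem_nhds ⟨h0, h1⟩

lemma StokesWave.harm_px (hw : StokesWave γ ψ η r Λ) {x y : ℝ}
    (h0 : 0 < y) (h1 : y < η x) : px (px (px ψ)) x y + py (py (px ψ)) x y = 0 := by
  have d := (hw.sm.px.px.hasx x y).add (hw.sm.py.py.hasx x y)
  have hc : ContinuousAt (fun t : ℝ => (t, y)) x := by fun_prop
  have ev : (fun t => px (px ψ) t y + py (py ψ) t y) =ᶠ[nhds x] fun _ => γ := by
    filter_upwards [hc.eventually (hw.nhds_dom h0 h1)] with t ht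
    exact hw.lap ht.1.le ht.2.le
  have d0 := (hasDerivAt_const x γ).congr_of_eventuallyEq ev
  have := d.unique d0
  rw [hw.sm.py.comm, hw.sm.comm] at this
  exact this

lemma StokesWave.harm_py (hw : StokesWave γ ψ η r Λ) {x y : ℝ}
    (h0 : 0 < y) (h1 : y < η x) : px (px (py ψ)) x y + py (py (py ψ)) x y = 0 := by
  have d := (hw.sm.px.px.hasy x y).add (hw.sm.py.py.hasy x y)
  have hc : ContinuousAt (fun t : ℝ => (x, t)) y := by fun_prop
  have ev : (fun t => px (px ψ) x t + py (py ψ) x t) =ᶠ[nhds y] fun _ => γ := by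
    filter_upwards [hc.eventually (hw.nhds_dom h0 h1)] with t ht
    exact hw.lap ht.1.le ht.2.le
  have d0 := (hasDerivAt_const y γ).congr_of_eventuallyEq ev
  have := d.unique d0
  rw [← hw.sm.px.comm, ← hw.sm.comm] at this
  exact this

lemma StokesWave.px_bot (hw : StokesWave γ ψ η r Λ) (x : ℝ) : px ψ x 0 = 0 := by
  have : (fun t => ψ t 0) = fun _ => 0 := by funext t; exact hw.sol.bottom_val t
  simp [px, this]

lemma StokesWave.pxx_bot (hw : StokesWave γ ψ η r Λ) (x : ℝ) : px (px ψ) x 0 = 0 := by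
  have : (fun t => px ψ t 0) = fun _ => 0 := by funext t; exact hw.px_bot t
  show deriv (fun t => px ψ t 0) x = 0
  simp [this]

lemma StokesWave.pyy_bot (hw : StokesWave γ ψ η r Λ) (x : ℝ) : py (py ψ) x 0 = γ := by
  have := hw.lap (x := x) (le_refl 0) (hw.sol.eta_pos x).le
  rw [hw.pxx_bot] at this
  linarith

lemma StokesWave.px_crest (hw : StokesWave γ ψ η r Λ) (y : ℝ) : px ψ 0 y = 0 := by
  have h1 := hw.sm.hasx 0 y
  have h2 : HasDerivAt (fun t : ℝ => ψ (-t) y) (-px ψ 0 y) 0 := by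
    have h1' : HasDerivAt (fun t => ψ t y) (px ψ 0 y) (-(0 : ℝ)) := by simpa using h1
    have := HasDerivAt.comp (0 : ℝ) h1' (hasDerivAt_neg (0 : ℝ))
    rw [mul_neg_one] at this
    exact this
  have : (fun t : ℝ => ψ (-t) y) = fun t => ψ t y := by funext t; exact hw.psi_even t y
  rw [this] at h2
  have := h1.unique h2
  linarith

lemma StokesWave.px_trough (hw : StokesWave γ ψ η r Λ) (y : ℝ) : px ψ Λ y = 0 := by
  have h1 := hw.sm.hasx Λ y
  have h2 : HasDerivAt (fun t : ℝ => ψ (2 * Λ - t) y) (-px ψ Λ y) Λ := by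
    have h1' : HasDerivAt (fun t => ψ t y) (px ψ Λ y) (2 * Λ - Λ) := by
      have : 2 * Λ - Λ = Λ := by ring
      rw [this]; exact h1
    have := HasDerivAt.comp (h := fun t : ℝ => 2 * Λ - t) Λ h1' ((hasDerivAt_id Λ).const_sub (2 * Λ))
    rw [mul_neg_one] at this
    exact this
  have : (fun t : ℝ => ψ (2 * Λ - t) y) = fun t => ψ t y := by
    funext t
    have : 2 * Λ - t = (-t) + 2 * Λ := by ring
    rw [this, hw.psi_periodic, hw.psi_even]
  rw [this] at h2
  have := h1.unique h2
  linarith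

lemma StokesWave.px_per (hw : StokesWave γ ψ η r Λ) (x y : ℝ) : px ψ (x + 2 * Λ) y = px ψ x y := by
  have : (fun t : ℝ => ψ (t + 2 * Λ) y) = fun t => ψ t y := by
    funext t; exact hw.psi_periodic t y
  unfold px
  rw [← deriv_comp_add_const, this]

lemma StokesWave.py_per (hw : StokesWave γ ψ η r Λ) (x y : ℝ) : py ψ (x + 2 * Λ) y = py ψ x y := by
  unfold py
  congr 1
  funext t; exact hw.psi_periodic x t

end basic


/-! ### The auxiliary functions built from the Bernoulli expression -/

section aux

variable {γ : ℝ} {ψ : ℝ → ℝ → ℝ} {η : ℝ → ℝ} {r Λ : ℝ}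

/-- `½|∇ψ|² - γψ + f(ψ)`. -/
def QF (γ : ℝ) (ψ : ℝ → ℝ → ℝ) (f : ℝ → ℝ) (x y : ℝ) : ℝ :=
  (px ψ x y) ^ 2 / 2 + (py ψ x y) ^ 2 / 2 - γ * ψ x y + f (ψ x y)

lemma Sm.QF (h : Sm ψ) {f : ℝ → ℝ} (hf : ContDiff ℝ (⊤ : ℕ∞) f) : Sm (QF γ ψ f) := by
  have h1 : ContDiff ℝ (⊤ : ℕ∞) (fun p : ℝ × ℝ => _root_.px ψ p.1 p.2) := h.px
  have h2 : ContDiff ℝ (⊤ : ℕ∞) (fun p : ℝ × ℝ => _root_.py ψ p.1 p.2) := h.py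
  have h3 : ContDiff ℝ (⊤ : ℕ∞) (fun p : ℝ × ℝ => ψ p.1 p.2) := h
  unfold Sm _root_.QF
  exact ((((h1.pow 2).div_const 2).add ((h2.pow 2).div_const 2)).sub
    (contDiff_const.mul h3)).add (hf.comp h3)

lemma px_QF (h : Sm ψ) {f f1 : ℝ → ℝ} (hf : ∀ t, HasDerivAt f (f1 t) t) :
    px (QF γ ψ f) = fun x y => px ψ x y * px (px ψ) x y + py ψ x y * px (py ψ) x y
      + (f1 (ψ x y) - γ) * px ψ x y := by
  funext x y
  have d := (((((h.px.hasx x y).pow 2).div_const 2).add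
    (((h.py.hasx x y).pow 2).div_const 2)).sub ((h.hasx x y).const_mul γ)).add
    (HasDerivAt.comp x (hf (ψ x y)) (h.hasx x y))
  refine HasDerivAt.deriv (HasDerivAt.congr_deriv d ?_)
  simp only [Nat.cast_ofNat]
  ring

lemma py_QF (h : Sm ψ) {f f1 : ℝ → ℝ} (hf : ∀ t, HasDerivAt f (f1 t) t) :
    py (QF γ ψ f) = fun x y => px ψ x y * py (px ψ) x y + py ψ x y * py (py ψ) x y
      + (f1 (ψ x y) - γ) * py ψ x y := by
  funext x y
  have d := (((((h.px.hasy x y).pow 2).div_const 2).add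
    (((h.py.hasy x y).pow 2).div_const 2)).sub ((h.hasy x y).const_mul γ)).add
    (HasDerivAt.comp y (hf (ψ x y)) (h.hasy x y))
  refine HasDerivAt.deriv (HasDerivAt.congr_deriv d ?_)
  simp only [Nat.cast_ofNat]
  ring

lemma pxx_QF (h : Sm ψ) {f f1 f2 : ℝ → ℝ} (hf : ∀ t, HasDerivAt f (f1 t) t)
    (hf1 : ∀ t, HasDerivAt f1 (f2 t) t) (x y : ℝ) :
    px (px (QF γ ψ f)) x y = px (px ψ) x y ^ 2 + px ψ x y * px (px (px ψ)) x y
      + px (py ψ) x y ^ 2 + py ψ x y * px (px (py ψ)) x y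
      + f2 (ψ x y) * px ψ x y ^ 2 + (f1 (ψ x y) - γ) * px (px ψ) x y := by
  rw [px_QF h hf]
  have d := (((h.px.hasx x y).mul (h.px.px.hasx x y)).add
    ((h.py.hasx x y).mul (h.py.px.hasx x y))).add
    (((HasDerivAt.comp x (hf1 (ψ x y)) (h.hasx x y)).sub_const γ).mul (h.px.hasx x y))
  refine HasDerivAt.deriv (HasDerivAt.congr_deriv d ?_)
  simp only [Function.comp]
  ring

lemma pyy_QF (h : Sm ψ) {f f1 f2 : ℝ → ℝ} (hf : ∀ t, HasDerivAt f (f1 t) t)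
    (hf1 : ∀ t, HasDerivAt f1 (f2 t) t) (x y : ℝ) :
    py (py (QF γ ψ f)) x y = py (px ψ) x y ^ 2 + px ψ x y * py (py (px ψ)) x y
      + py (py ψ) x y ^ 2 + py ψ x y * py (py (py ψ)) x y
      + f2 (ψ x y) * py ψ x y ^ 2 + (f1 (ψ x y) - γ) * py (py ψ) x y := by
  rw [py_QF h hf]
  have d := (((h.px.hasy x y).mul (h.px.py.hasy x y)).add
    ((h.py.hasy x y).mul (h.py.py.hasy x y))).add
    (((HasDerivAt.comp y (hf1 (ψ x y)) (h.hasy x y)).sub_const γ).mul (h.py.hasy x y))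
  refine HasDerivAt.deriv (HasDerivAt.congr_deriv d ?_)
  simp only [Function.comp]
  ring

lemma alg_key {a b c u v l : ℝ} (hv : v ≠ 0)
    (e1 : u * a + v * b = l * u) (e2 : u * b + v * c = l * v) :
    a * c - b ^ 2 = l * (a + c - l) := by
  have h1 : v ^ 2 * ((l - a) * (l - c) - b ^ 2) = 0 := by
    have e3 : v * b = (l - a) * u := by linarith
    have e4 : u * b = (l - c) * v := by linarith
    have : v * ((l - a) * (l - c) - b ^ 2) = 0 := by
      calc v * ((l - a) * (l - c) - b ^ 2) = (l - a) * ((l - c) * v) - b * (v * b) := by ring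
        _ = 0 := by rw [← e4, e3]; ring
    calc v ^ 2 * ((l - a) * (l - c) - b ^ 2) = v * (v * ((l - a) * (l - c) - b ^ 2)) := by ring
      _ = 0 := by rw [this]; ring
  have h2 : (l - a) * (l - c) - b ^ 2 = 0 := by
    rcases mul_eq_zero.1 h1 with h | h
    · exact absurd h (pow_ne_zero 2 hv)
    · exact h
  linarith

lemma StokesWave.QF_lap (hw : StokesWave γ ψ η r Λ) (hu : Unidirectional ψ η)
    {f f1 f2 : ℝ → ℝ} (hf : ∀ t, HasDerivAt f (f1 t) t)
    (hf1 : ∀ t, HasDerivAt f1 (f2 t) t) {x y : ℝ} (h0 : 0 < y) (h1 : y < η x)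
    (cx : px (QF γ ψ f) x y = 0) (cy : py (QF γ ψ f) x y = 0) :
    px (px (QF γ ψ f)) x y + py (py (QF γ ψ f)) x y
      = 2 * f1 (ψ x y) ^ 2 - γ * f1 (ψ x y) + f2 (ψ x y) * (px ψ x y ^ 2 + py ψ x y ^ 2) := by
  have hl := hw.lap h0.le h1.le
  have k1 := hw.harm_px h0 h1
  have k2 := hw.harm_py h0 h1
  rw [pxx_QF hw.sm hf hf1, pyy_QF hw.sm hf hf1]
  rw [px_QF hw.sm hf] at cx
  rw [py_QF hw.sm hf] at cy
  beta_reduce at cx cy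
  have hc : py (px ψ) x y = px (py ψ) x y := by rw [hw.sm.comm]
  rw [hc] at cy ⊢
  have key := alg_key (a := px (px ψ) x y) (b := px (py ψ) x y) (c := py (py ψ) x y)
    (u := px ψ x y) (v := py ψ x y) (l := γ - f1 (ψ x y)) (hu x y h0 h1).ne'
    (by linarith) (by linarith)
  rw [hl] at key
  have e1 : px (px (px ψ)) x y = - py (py (px ψ)) x y := by linarith
  have e2 : px (px (py ψ)) x y = - py (py (py ψ)) x y := by linarith
  have e3 : px (px ψ) x y = γ - py (py ψ) x y := by linarith
  rw [e1, e2]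
  rw [e3] at key ⊢
  linear_combination (-2) * key

lemma StokesWave.local_max (hw : StokesWave γ ψ η r Λ) {Q : ℝ → ℝ → ℝ} {x y : ℝ} (h0 : 0 < y)
    (h1 : y < η x) (hm : ∀ x' y', 0 ≤ y' → y' ≤ η x' → Q x' y' ≤ Q x y) :
    IsLocalMax (fun p : ℝ × ℝ => Q p.1 p.2) (x, y) := by
  filter_upwards [hw.nhds_dom h0 h1] with p hp
  exact hm _ _ hp.1.le hp.2.le

lemma StokesWave.QF_per (hw : StokesWave γ ψ η r Λ) (f : ℝ → ℝ) (x y : ℝ) :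
    QF γ ψ f (x + 2 * Λ) y = QF γ ψ f x y := by
  unfold QF; rw [hw.px_per, hw.py_per, hw.psi_periodic]

/-- Upper bound for `½|∇ψ|² - γψ`. -/
lemma StokesWave.P_le (hw : StokesWave γ ψ η r Λ) (hu : Unidirectional ψ η) (hγ : 0 < γ)
    {T : ℝ} (hT : 0 ≤ T) (hr : ∀ x, r - γ - η x ≤ T) {x y : ℝ} (h0 : 0 ≤ y) (h1 : y ≤ η x) :
    px ψ x y ^ 2 / 2 + py ψ x y ^ 2 / 2 - γ * ψ x y ≤ T := by
  by_contra hcon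
  push Not at hcon
  obtain ⟨S, hS⟩ : ∃ S, S = px ψ x y ^ 2 / 2 + py ψ x y ^ 2 / 2 - γ * ψ x y := ⟨_, rfl⟩
  rw [← hS] at hcon
  have hS0 : 0 < S := by linarith
  obtain ⟨k, hk⟩ : ∃ k, k = γ / S := ⟨_, rfl⟩
  have hk0 : 0 < k := by rw [hk]; positivity
  have hkS : k * S = γ := by rw [hk]; field_simp
  obtain ⟨ε, hε⟩ : ∃ ε, ε = (S - T) / (2 * Real.exp k) := ⟨_, rfl⟩
  have hε0 : 0 < ε := by
    rw [hε]; have := Real.exp_pos k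
    have : 0 < S - T := by linarith
    positivity
  have hεk : ε * Real.exp k = (S - T) / 2 := by
    rw [hε]; have := (Real.exp_pos k).ne'
    field_simp
  have hf : ∀ t, HasDerivAt (fun t => ε * Real.exp (k * t)) (ε * k * Real.exp (k * t)) t := by
    intro t
    have := (((hasDerivAt_id t).const_mul k).exp).const_mul ε
    refine HasDerivAt.congr_deriv this ?_
    simp only [id]; ring
  have hf1 : ∀ t, HasDerivAt (fun t => ε * k * Real.exp (k * t))
      (ε * k ^ 2 * Real.exp (k * t)) t := by
    intro t
    have := (((hasDerivAt_id t).const_mul k).exp).const_mul (ε * k)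
    refine HasDerivAt.congr_deriv this ?_
    simp only [id]; ring
  have hfs : ContDiff ℝ (⊤ : ℕ∞) (fun t => ε * Real.exp (k * t)) := by fun_prop
  have hQ : Sm (QF γ ψ (fun t => ε * Real.exp (k * t))) := hw.sm.QF hfs
  obtain ⟨x₀, y₀, a0, a1, hmax⟩ := exists_max_periodic (L := 2 * Λ) (by linarith [hw.lam_pos])
    hQ.cont hw.etac (hw.QF_per _) hw.eta_periodic (fun x => (hw.sol.eta_pos x).le)
  have hv := hmax x y h0 h1
  have hQ0 : S ≤ QF γ ψ (fun t => ε * Real.exp (k * t)) x₀ y₀ := by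
    refine le_trans ?_ hv
    unfold QF
    rw [← hS]
    have := Real.exp_pos (k * ψ x y)
    have : 0 < ε * Real.exp (k * ψ x y) := by positivity
    linarith
  have hexp : ε * Real.exp (k * ψ x₀ y₀) ≤ (S - T) / 2 := by
    rw [← hεk]
    have : k * ψ x₀ y₀ ≤ k := by
      have := hw.psi_le_one hu a0 a1
      nlinarith
    have := Real.exp_le_exp.2 this
    nlinarith
  have hP0 : (S + T) / 2 ≤ px ψ x₀ y₀ ^ 2 / 2 + py ψ x₀ y₀ ^ 2 / 2 - γ * ψ x₀ y₀ := by
    unfold QF at hQ0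
    linarith
  have hψ0 := hw.psi_nonneg hu a0 a1
  have hgrad : S ≤ px ψ x₀ y₀ ^ 2 + py ψ x₀ y₀ ^ 2 := by
    have : 0 ≤ γ * ψ x₀ y₀ := by positivity
    linarith
  have hE := Real.exp_pos (k * ψ x₀ y₀)
  rcases a1.lt_or_eq with b1 | b1
  · rcases a0.lt_or_eq with b0 | b0
    · obtain ⟨c1, c2, c3, c4⟩ := locmax hQ (hw.local_max b0 b1 hmax)
      have := hw.QF_lap hu hf hf1 b0 b1 c1 c2
      have h5 : 0 < 2 * (ε * k * Real.exp (k * ψ x₀ y₀)) ^ 2 := by positivity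
      have h6 : ε * k ^ 2 * Real.exp (k * ψ x₀ y₀) * S
          ≤ ε * k ^ 2 * Real.exp (k * ψ x₀ y₀) * (px ψ x₀ y₀ ^ 2 + py ψ x₀ y₀ ^ 2) := by
        gcongr
      have h7 : ε * k ^ 2 * Real.exp (k * ψ x₀ y₀) * S = γ * (ε * k * Real.exp (k * ψ x₀ y₀)) := by
        rw [← hkS]; ring
      linarith
    · subst b0
      have hd := hQ.hasy x₀ 0
      have hle : py (QF γ ψ (fun t => ε * Real.exp (k * t))) x₀ 0 ≤ 0 := by
        apply deriv_right_nonpos hd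
        have : Ioo 0 (η x₀) ∈ nhdsWithin (0 : ℝ) (Ioi 0) := Ioo_mem_nhdsGT (hw.sol.eta_pos x₀)
        filter_upwards [this] with y hy
        exact hmax _ _ hy.1.le hy.2.le
      rw [py_QF hw.sm hf] at hle
      simp only [hw.px_bot, hw.pyy_bot] at hle
      have hb := hw.py_nonneg hu (le_refl 0) a1
      rw [hw.px_bot] at hgrad
      have hb' : 0 < py ψ x₀ 0 := by
        rcases hb.lt_or_eq with h | h
        · exact h
        · rw [← h] at hgrad; linarith
      have : 0 < ε * k * Real.exp (k * ψ x₀ 0) * py ψ x₀ 0 := by positivity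
      linarith
  · have hb := hw.sol.bernoulli x₀
    rw [b1, hw.sol.surface_val] at hP0
    have := hr x₀
    linarith

end aux


/-! ### Trough depth, gradient bound, and behaviour near the bottom below the crest -/

section trough

variable {γ : ℝ} {ψ : ℝ → ℝ → ℝ} {η : ℝ → ℝ} {r Λ : ℝ}

lemma crit_bound {sc d : ℝ} (hγ : 0 < γ) (hd : d = Real.sqrt (2 * γ) / γ) (hc : IsCrit γ sc)
    (hr : bernR γ sc < r) : γ + d - 1 / γ ^ 2 ≤ r := by
  obtain ⟨h0, h1⟩ := hc
  have h2 : 0 ≤ sc / (γ * Real.sqrt (sc ^ 2 + 2 * γ)) := by positivity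
  have h3 : sc ≤ 1 / γ := by linarith
  unfold bernR lamDepth at hr
  have h4 : Real.sqrt (2 * γ) ≤ Real.sqrt (sc ^ 2 + 2 * γ) :=
    Real.sqrt_le_sqrt (by nlinarith [sq_nonneg sc])
  have h5 : (-(1 / γ) + Real.sqrt (2 * γ)) / γ ≤ (-sc + Real.sqrt (sc ^ 2 + 2 * γ)) / γ := by
    gcongr
  have h6 : (-(1 / γ) + Real.sqrt (2 * γ)) / γ = d - 1 / γ ^ 2 := by
    rw [hd]; field_simp; ring
  have := sq_nonneg sc
  linarith

lemma StokesWave.trough_ge (hw : StokesWave γ ψ η r Λ) (hu : Unidirectional ψ η) (hγ : 0 < γ)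
    {d : ℝ} (hd : 0 < d) (hd2 : γ * d ^ 2 = 2) (hr : r ≤ γ + d) : d - 2 / γ ^ 2 ≤ η Λ := by
  by_contra hcon
  push Not at hcon
  obtain ⟨t, ht⟩ : ∃ t, t = d - η Λ := ⟨_, rfl⟩
  have hg2 : 0 < 2 / γ ^ 2 := by positivity
  have ht0 : 2 / γ ^ 2 < t := by linarith
  have htp : 0 < t := by linarith
  have hP : ∀ y, 0 ≤ y → y ≤ η Λ → py ψ Λ y ^ 2 ≤ 2 * γ * ψ Λ y + 2 * t := by
    intro y a b
    have := hw.P_le hu hγ htp.le (fun x => by linarith [hw.eta_ge x]) a b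
    rw [hw.px_trough] at this
    linarith
  have hpos : ∀ y, 0 ≤ y → y ≤ η Λ → 0 < 2 * γ * ψ Λ y + 2 * t := by
    intro y a b
    have := hw.psi_nonneg hu a b
    positivity
  have hanti : AntitoneOn (fun y => Real.sqrt (2 * γ * ψ Λ y + 2 * t) - γ * y) (Icc 0 (η Λ)) := by
    have hc := hw.sm.conty Λ
    apply antitoneOn_of_deriv_nonpos (convex_Icc _ _)
    · exact Continuous.continuousOn (by fun_prop)
    · intro y hy
      rw [interior_Icc] at hy
      have hp := hpos y hy.1.le hy.2.le
      have hd := ((((hw.sm.hasy Λ y).const_mul (2 * γ)).add_const (2 * t)).sqrt hp.ne').sub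
        ((hasDerivAt_id y).const_mul γ)
      exact hd.differentiableAt.differentiableWithinAt
    · intro y hy
      rw [interior_Icc] at hy
      have hp := hpos y hy.1.le hy.2.le
      have hd := ((((hw.sm.hasy Λ y).const_mul (2 * γ)).add_const (2 * t)).sqrt hp.ne').sub
        ((hasDerivAt_id y).const_mul γ)
      have he : deriv (fun y => Real.sqrt (2 * γ * ψ Λ y + 2 * t) - γ * y) y = _ := hd.deriv
      rw [he]
      have h1 : py ψ Λ y ≤ Real.sqrt (2 * γ * ψ Λ y + 2 * t) :=
        Real.le_sqrt_of_sq_le (hP y hy.1.le hy.2.le)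
      have h2 : 0 < Real.sqrt (2 * γ * ψ Λ y + 2 * t) := Real.sqrt_pos.2 hp
      have h3 : 2 * γ * py ψ Λ y / (2 * Real.sqrt (2 * γ * ψ Λ y + 2 * t)) ≤ γ := by
        rw [div_le_iff₀ (by positivity)]
        nlinarith
      linarith
  have hη := hw.sol.eta_pos Λ
  have h1 := hanti ⟨le_refl 0, hη.le⟩ ⟨hη.le, le_refl _⟩ hη.le
  simp only [hw.sol.surface_val, hw.sol.bottom_val, mul_zero, mul_one, zero_add, sub_zero] at h1
  obtain ⟨q, hq⟩ : ∃ q, q = Real.sqrt (2 * t) := ⟨_, rfl⟩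
  have hq0 : 0 < q := by rw [hq]; exact Real.sqrt_pos.2 (by linarith)
  have hq2 : q ^ 2 = 2 * t := by rw [hq]; exact Real.sq_sqrt (by linarith)
  rw [← hq] at h1
  have h2 : Real.sqrt (2 * γ + 2 * t) ≤ q + γ * η Λ := by linarith
  have h3 := (Real.sqrt_le_left (by positivity)).1 h2
  have h4 : (γ * d) ^ 2 ≤ (q + γ * η Λ) ^ 2 := by
    have : (γ * d) ^ 2 = 2 * γ := by rw [mul_pow, sq γ, mul_assoc, hd2]; ring
    rw [this]; linarith
  have h5 : γ * d ≤ q + γ * η Λ := by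
    apply le_of_sq_le_sq h4 |> fun h => h
    positivity
  have h6 : γ * t ≤ q := by rw [ht]; linarith
  have h7 : (γ * t) ^ 2 ≤ 2 * t := by
    rw [← hq2]; exact pow_le_pow_left₀ (by positivity) h6 2
  have h8 : γ ^ 2 * t ≤ 2 := by
    have : t * (γ ^ 2 * t) ≤ t * 2 := by nlinarith
    exact le_of_mul_le_mul_left this htp
  have h9 : t ≤ 2 / γ ^ 2 := by
    rw [le_div_iff₀ (by positivity)]; linarith
  linarith

/-- A test polynomial. -/
def pol (a b e m y₀ k n x y : ℝ) : ℝ :=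
  a * x ^ 2 + b * (y - e) ^ 2 + y * (m * (y - y₀) ^ 2 + k * x + n * x ^ 2)

lemma hasx_pol (a b e m y₀ k n x y : ℝ) :
    HasDerivAt (fun t => pol a b e m y₀ k n t y) (2 * a * x + y * (k + 2 * n * x)) x := by
  have := ((((hasDerivAt_id x).pow 2).const_mul a).add_const (b * (y - e) ^ 2)).add
    (((((hasDerivAt_id x).const_mul k).const_add (m * (y - y₀) ^ 2)).add
      (((hasDerivAt_id x).pow 2).const_mul n)).const_mul y)
  refine HasDerivAt.congr_deriv this ?_
  simp only [id, Nat.cast_ofNat]; ring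

lemma hasy_pol (a b e m y₀ k n x y : ℝ) :
    HasDerivAt (fun t => pol a b e m y₀ k n x t) (2 * b * (y - e) + (m * (y - y₀) ^ 2
      + k * x + n * x ^ 2) + y * (2 * m * (y - y₀))) y := by
  have := (((((hasDerivAt_id y).sub_const e).pow 2).const_mul b).const_add (a * x ^ 2)).add
    ((hasDerivAt_id y).mul ((((((hasDerivAt_id y).sub_const y₀).pow 2).const_mul m).add_const
      (k * x)).add_const (n * x ^ 2)))
  refine HasDerivAt.congr_deriv this ?_
  simp only [id, Nat.cast_ofNat, Pi.pow_apply]; ring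

lemma hasxx_pol (a b e m y₀ k n x y : ℝ) :
    HasDerivAt (fun t => px (pol a b e m y₀ k n) t y) (2 * a + 2 * n * y) x := by
  have h : (fun t => px (pol a b e m y₀ k n) t y) = fun t => 2 * a * t + y * (k + 2 * n * t) := by
    funext t; exact (hasx_pol a b e m y₀ k n t y).deriv
  rw [h]
  have := ((hasDerivAt_id x).const_mul (2 * a)).add
    ((((hasDerivAt_id x).const_mul (2 * n)).const_add k).const_mul y)
  refine HasDerivAt.congr_deriv this ?_
  ring

lemma hasyy_pol (a b e m y₀ k n x y : ℝ) :
    HasDerivAt (fun t => py (pol a b e m y₀ k n) x t)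
      (2 * b + 4 * m * (y - y₀) + 2 * m * y) y := by
  have h : (fun t => py (pol a b e m y₀ k n) x t) = fun t => 2 * b * (t - e) + (m * (t - y₀) ^ 2
      + k * x + n * x ^ 2) + t * (2 * m * (t - y₀)) := by
    funext t; exact (hasy_pol a b e m y₀ k n x t).deriv
  rw [h]
  have := ((((hasDerivAt_id y).sub_const e).const_mul (2 * b)).add
    ((((((hasDerivAt_id y).sub_const y₀).pow 2).const_mul m).add_const
      (k * x)).add_const (n * x ^ 2))).add
      ((hasDerivAt_id y).mul (((hasDerivAt_id y).sub_const y₀).const_mul (2 * m)))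
  refine HasDerivAt.congr_deriv this ?_
  simp only [id, Nat.cast_ofNat]; ring

lemma sm_pol (a b e m y₀ k n : ℝ) : Sm (pol a b e m y₀ k n) := by
  unfold Sm pol; fun_prop

lemma Sm.sub {φ q : ℝ → ℝ → ℝ} (h : Sm φ) (hq : Sm q) : Sm (fun x y => φ x y - q x y) :=
  ContDiff.sub h hq

lemma px_sub {φ q : ℝ → ℝ → ℝ} (h : Sm φ) (hq : Sm q) :
    px (fun x y => φ x y - q x y) = fun x y => px φ x y - px q x y := by
  funext x y; exact ((h.hasx x y).sub (hq.hasx x y)).deriv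

lemma py_sub {φ q : ℝ → ℝ → ℝ} (h : Sm φ) (hq : Sm q) :
    py (fun x y => φ x y - q x y) = fun x y => py φ x y - py q x y := by
  funext x y; exact ((h.hasy x y).sub (hq.hasy x y)).deriv

lemma polmax {φ : ℝ → ℝ → ℝ} (h : Sm φ) {a b e m y₀ k n x y : ℝ}
    (hm : IsLocalMax (fun p : ℝ × ℝ => φ p.1 p.2 - pol a b e m y₀ k n p.1 p.2) (x, y)) :
    px (px φ) x y + py (py φ) x y ≤
      (2 * a + 2 * n * y) + (2 * b + 4 * m * (y - y₀) + 2 * m * y) := by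
  have hp := sm_pol a b e m y₀ k n
  obtain ⟨-, -, c3, c4⟩ := locmax (h.sub hp) hm
  rw [px_sub h hp, px_sub h.px hp.px] at c3
  rw [py_sub h hp, py_sub h.py hp.py] at c4
  have e1 : px (px (pol a b e m y₀ k n)) x y = _ := (hasxx_pol a b e m y₀ k n x y).deriv
  have e2 : py (py (pol a b e m y₀ k n)) x y = _ := (hasyy_pol a b e m y₀ k n x y).deriv
  beta_reduce at c3 c4
  rw [e1] at c3
  rw [e2] at c4
  linarith

lemma polmin {φ : ℝ → ℝ → ℝ} (h : Sm φ) {a b e m y₀ k n x y : ℝ}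
    (hm : IsLocalMin (fun p : ℝ × ℝ => φ p.1 p.2 - pol a b e m y₀ k n p.1 p.2) (x, y)) :
    (2 * a + 2 * n * y) + (2 * b + 4 * m * (y - y₀) + 2 * m * y) ≤
      px (px φ) x y + py (py φ) x y := by
  have hp := sm_pol a b e m y₀ k n
  obtain ⟨-, -, c3, c4⟩ := locmin (h.sub hp) hm
  rw [px_sub h hp, px_sub h.px hp.px] at c3
  rw [py_sub h hp, py_sub h.py hp.py] at c4
  have e1 : px (px (pol a b e m y₀ k n)) x y = _ := (hasxx_pol a b e m y₀ k n x y).deriv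
  have e2 : py (py (pol a b e m y₀ k n)) x y = _ := (hasyy_pol a b e m y₀ k n x y).deriv
  beta_reduce at c3 c4
  rw [e1] at c3
  rw [e2] at c4
  linarith

lemma StokesWave.strip (hw : StokesWave γ ψ η r Λ) {M H : ℝ} (hM : 0 < M) (hH : 0 < H)
    (hHη : ∀ x, H ≤ η x) (hb : ∀ x y, 0 ≤ y → y ≤ η x → px ψ x y ≤ M) {x y : ℝ}
    (h0 : 0 ≤ y) (h1 : y ≤ H) : px ψ x y ≤ 2 * M / H * y := by
  obtain ⟨c, hc⟩ : ∃ c, c = M / H ^ 2 := ⟨_, rfl⟩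
  have hc0 : 0 < c := by rw [hc]; positivity
  have hcH : c * H ^ 2 = M := by rw [hc]; field_simp
  have hG : Sm (fun x y => px ψ x y - pol 0 (-c) H 0 0 0 0 x y) := hw.sm.px.sub (sm_pol _ _ _ _ _ _ _)
  obtain ⟨x₀, y₀, a0, a1, hmax⟩ := exists_max_periodic (L := 2 * Λ) (τ := fun _ => H)
    (f := fun x y => px ψ x y - pol 0 (-c) H 0 0 0 0 x y)
    (by linarith [hw.lam_pos]) hG.cont continuous_const
    (fun x y => by simp only [hw.px_per, pol]; ring) (fun _ => rfl) (fun _ => hH.le)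
  have hle : px ψ x₀ y₀ - pol 0 (-c) H 0 0 0 0 x₀ y₀ ≤ M := by
    rcases a1.lt_or_eq with b1 | b1
    · rcases a0.lt_or_eq with b0 | b0
      · exfalso
        have hloc : IsLocalMax (fun p : ℝ × ℝ => px ψ p.1 p.2 - pol 0 (-c) H 0 0 0 0 p.1 p.2)
            (x₀, y₀) := by
          have o : IsOpen {p : ℝ × ℝ | 0 < p.2 ∧ p.2 < H} :=
            (isOpen_lt continuous_const continuous_snd).inter
              (isOpen_lt continuous_snd continuous_const)
          filter_upwards [o.mem_nhds (show (x₀, y₀) ∈ {p : ℝ × ℝ | 0 < p.2 ∧ p.2 < H} from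
            ⟨b0, b1⟩)] with p hp
          exact hmax _ _ hp.1.le hp.2.le
        have := polmax hw.sm.px hloc
        rw [hw.harm_px b0 (lt_of_lt_of_le b1 (hHη x₀))] at this
        linarith
      · rw [← b0, hw.px_bot, ← hcH]; unfold pol
        apply le_of_eq; ring
    · have := hb x₀ y₀ a0 (a1.trans (hHη _))
      rw [b1] at this ⊢
      unfold pol
      nlinarith
  have h3 := (hmax x y h0 h1).trans hle
  unfold pol at h3
  have h4 : 2 * M / H * y = 2 * c * H * y := by rw [hc]; field_simp
  rw [h4]
  nlinarith [mul_nonneg hc0.le (sq_nonneg y)]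

lemma StokesWave.box (hw : StokesWave γ ψ η r Λ) {M H y₀ : ℝ} (hM : 0 < M) (hH : 0 < H)
    (hHη : ∀ x, H ≤ η x) (hb : ∀ x y, 0 ≤ y → y ≤ η x → px ψ x y ≤ M)
    (hy0 : 0 < y₀) (hy1 : y₀ ≤ H / 2) : px (px ψ) 0 y₀ ≤ 32 * M / H ^ 2 * y₀ := by
  obtain ⟨A, hA⟩ : ∃ A, A = 8 * M / H ^ 3 := ⟨_, rfl⟩
  have hA0 : 0 < A := by rw [hA]; positivity
  have hG : Sm (fun x y => px ψ x y - pol 0 0 0 A y₀ (4 * H * A) (-3 * A) x y) :=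
    hw.sm.px.sub (sm_pol _ _ _ _ _ _ _)
  have hK : IsCompact (Icc (0 : ℝ) H ×ˢ Icc (0 : ℝ) H) := isCompact_Icc.prod isCompact_Icc
  obtain ⟨⟨x', y'⟩, ⟨⟨a1, a2⟩, ⟨a3, a4⟩⟩, hmax⟩ := hK.exists_isMaxOn
    ⟨(0, 0), ⟨⟨le_refl _, hH.le⟩, ⟨le_refl _, hH.le⟩⟩⟩ hG.cont.continuousOn
  simp only at a1 a2 a3 a4
  have hmax' : ∀ x y, 0 ≤ x → x ≤ H → 0 ≤ y → y ≤ H →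
      px ψ x y - pol 0 0 0 A y₀ (4 * H * A) (-3 * A) x y ≤
      px ψ x' y' - pol 0 0 0 A y₀ (4 * H * A) (-3 * A) x' y' := by
    intro x y b1 b2 b3 b4
    exact hmax (a := (x, y)) ⟨⟨b1, b2⟩, ⟨b3, b4⟩⟩
  have hstrip : px ψ x' y' ≤ A * H ^ 2 / 4 * y' := by
    have := hw.strip hM hH hHη hb (x := x') a3 a4
    have e : A * H ^ 2 / 4 = 2 * M / H := by rw [hA]; field_simp; ring
    rw [e]; exact this
  have hpol : pol 0 0 0 A y₀ (4 * H * A) (-3 * A) x' y' =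
      A * y' * ((y' - y₀) ^ 2 + 4 * H * x' - 3 * x' ^ 2) := by unfold pol; ring
  have hx3 : 0 ≤ 4 * H * x' - 3 * x' ^ 2 := by nlinarith
  have hAy : 0 ≤ A * y' := by positivity
  have hle : px ψ x' y' - pol 0 0 0 A y₀ (4 * H * A) (-3 * A) x' y' ≤ 0 := by
    rw [hpol]
    rcases a1.lt_or_eq with b1 | b1
    · rcases a2.lt_or_eq with b2 | b2
      · rcases a3.lt_or_eq with b3 | b3
        · rcases a4.lt_or_eq with b4 | b4
          · exfalso
            have hloc : IsLocalMax (fun p : ℝ × ℝ => px ψ p.1 p.2 -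
                pol 0 0 0 A y₀ (4 * H * A) (-3 * A) p.1 p.2) (x', y') := by
              have o : Icc (0 : ℝ) H ×ˢ Icc (0 : ℝ) H ∈ nhds (x', y') :=
                prod_mem_nhds (Icc_mem_nhds b1 b2) (Icc_mem_nhds b3 b4)
              filter_upwards [o] with p hp
              exact hmax' _ _ hp.1.1 hp.1.2 hp.2.1 hp.2.2
            have := polmax hw.sm.px hloc
            rw [hw.harm_px b3 (lt_of_lt_of_le b4 (hHη x'))] at this
            nlinarith
          · have : H ^ 2 / 4 ≤ (y' - y₀) ^ 2 + 4 * H * x' - 3 * x' ^ 2 := by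
              have : (H / 2) ^ 2 ≤ (y' - y₀) ^ 2 := by
                apply pow_le_pow_left₀ (by linarith); linarith
              nlinarith
            nlinarith [mul_le_mul_of_nonneg_left this hAy]
        · rw [← b3, hw.px_bot]; simp
      · have : H ^ 2 / 4 ≤ (y' - y₀) ^ 2 + 4 * H * x' - 3 * x' ^ 2 := by
          rw [b2]; nlinarith [sq_nonneg (y' - y₀), sq_nonneg H]
        nlinarith [mul_le_mul_of_nonneg_left this hAy]
    · have : 0 ≤ A * y' * ((y' - y₀) ^ 2 + 4 * H * x' - 3 * x' ^ 2) := by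
        apply mul_nonneg hAy
        nlinarith [sq_nonneg (y' - y₀)]
      rw [← b1] at this ⊢
      rw [hw.px_crest]
      linarith
  have hd := hG.hasx 0 y₀
  have hfin : px (fun x y => px ψ x y - pol 0 0 0 A y₀ (4 * H * A) (-3 * A) x y) 0 y₀ ≤ 0 := by
    apply deriv_right_nonpos hd
    filter_upwards [Ioo_mem_nhdsGT hH] with x hx
    have h1 := (hmax' x y₀ hx.1.le hx.2.le hy0.le (by linarith)).trans hle
    have h2 : px ψ 0 y₀ - pol 0 0 0 A y₀ (4 * H * A) (-3 * A) 0 y₀ = 0 := by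
      rw [hw.px_crest]; unfold pol; ring
    rw [h2]; exact h1
  rw [px_sub hw.sm.px (sm_pol _ _ _ _ _ _ _)] at hfin
  have e1 : px (pol 0 0 0 A y₀ (4 * H * A) (-3 * A)) 0 y₀ = _ :=
    (hasx_pol 0 0 0 A y₀ (4 * H * A) (-3 * A) 0 y₀).deriv
  beta_reduce at hfin
  rw [e1] at hfin
  have e2 : 32 * M / H ^ 2 * y₀ = 4 * H * A * y₀ := by rw [hA]; field_simp; ring
  rw [e2]
  linarith

/-- Lower bound for `ψ` below the crest. -/
lemma StokesWave.psi_low (hw : StokesWave γ ψ η r Λ) (hu : Unidirectional ψ η) {σ : ℝ}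
    (hσ : 0 < σ) (hγ : γ = σ ^ 2) (hHη : ∀ x, 1 / σ ≤ η x)
    (hb : ∀ x y, 0 ≤ y → y ≤ η x → px ψ x y ≤ 2 * σ) {y : ℝ} (h0 : 1 / (128 * σ) ≤ y)
    (h1 : y ≤ η 0) : 1 / 65536 ≤ ψ 0 y := by
  have hy1 : 1 / (128 * σ) ≤ 1 / σ / 2 := by
    rw [div_div]; exact one_div_le_one_div_of_le (by positivity) (by linarith)
  have hp1 : 0 < 1 / (128 * σ) := by positivity
  have hp2 : 0 < 1 / σ := by positivity
  have hyy : ∀ y, 0 < y → y ≤ 1 / (128 * σ) → γ / 2 ≤ py (py ψ) 0 y := by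
    intro y a b
    have k1 := hw.box (M := 2 * σ) (H := 1 / σ) (by positivity) (by positivity) hHη hb a
      (b.trans hy1)
    have k2 := hw.lap (x := 0) a.le (by linarith [hHη 0])
    have k3 : 32 * (2 * σ) / (1 / σ) ^ 2 * y ≤ γ / 2 := by
      calc 32 * (2 * σ) / (1 / σ) ^ 2 * y ≤ 32 * (2 * σ) / (1 / σ) ^ 2 * (1 / (128 * σ)) := by
            gcongr
        _ = γ / 2 := by rw [hγ]; field_simp; norm_num
    linarith
  have m1 : MonotoneOn (fun y => py ψ 0 y - γ / 2 * y) (Icc 0 (1 / (128 * σ))) := by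
    have hc := hw.sm.py.conty 0
    have hd : ∀ y, HasDerivAt (fun y => py ψ 0 y - γ / 2 * y) (py (py ψ) 0 y - γ / 2 * 1) y :=
      fun y => (hw.sm.py.hasy 0 y).sub ((hasDerivAt_id y).const_mul (γ / 2))
    apply monotoneOn_of_deriv_nonneg (convex_Icc _ _)
    · exact Continuous.continuousOn (by fun_prop)
    · exact fun y _ => (hd y).differentiableAt.differentiableWithinAt
    · intro y hy
      rw [interior_Icc] at hy
      rw [(hd y).deriv]
      linarith [hyy y hy.1 hy.2.le]
  have m2 : MonotoneOn (fun y => ψ 0 y - γ / 4 * y ^ 2) (Icc 0 (1 / (128 * σ))) := by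
    have hc := hw.sm.conty 0
    have hd : ∀ y, HasDerivAt (fun y => ψ 0 y - γ / 4 * y ^ 2) (py ψ 0 y - γ / 2 * y) y := by
      intro y
      have := (hw.sm.hasy 0 y).sub (((hasDerivAt_id y).pow 2).const_mul (γ / 4))
      refine HasDerivAt.congr_deriv this ?_
      simp only [id, Nat.cast_ofNat]; ring
    apply monotoneOn_of_deriv_nonneg (convex_Icc _ _)
    · exact Continuous.continuousOn (by fun_prop)
    · exact fun y _ => (hd y).differentiableAt.differentiableWithinAt
    · intro y hy
      rw [interior_Icc] at hy
      rw [(hd y).deriv]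
      have := m1 ⟨le_refl 0, hp1.le⟩ ⟨hy.1.le, hy.2.le⟩ hy.1.le
      have k := hw.py_nonneg hu (x := 0) (le_refl 0) (hw.sol.eta_pos 0).le
      simp only [mul_zero, sub_zero] at this
      linarith
  have h3 := m2 ⟨le_refl 0, hp1.le⟩ ⟨hp1.le, le_refl _⟩ hp1.le
  simp only [hw.sol.bottom_val] at h3
  have h4 : γ / 4 * (1 / (128 * σ)) ^ 2 = 1 / 65536 := by rw [hγ]; field_simp; norm_num
  rw [h4] at h3
  have h5 := (hw.psi_strictMono hu 0).monotoneOn ⟨hp1.le, h0.trans h1⟩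
    ⟨hp1.le.trans h0, h1⟩ h0
  beta_reduce at h5
  linarith

end trough


/-! ### A crude upper bound for the crest -/

section crest

variable {γ : ℝ} {ψ : ℝ → ℝ → ℝ} {η : ℝ → ℝ} {r Λ : ℝ}

lemma StokesWave.lemR (hw : StokesWave γ ψ η r Λ) (hu : Unidirectional ψ η) {σ b : ℝ}
    (hσ : 0 < σ) (hγ : γ = σ ^ 2) (hb : 0 < b) (hb2 : γ * b ^ 2 = 2 - 1 / 65536)
    (hlow : ∀ y, 1 / (128 * σ) ≤ y → y ≤ η 0 → 1 / 65536 ≤ ψ 0 y) :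
    η (min b Λ) ≤ 2049 / σ := by
  obtain ⟨y₁, hy₁⟩ : ∃ y₁, y₁ = 1 / (128 * σ) := ⟨_, rfl⟩
  obtain ⟨N, hN⟩ : ∃ N, N = 1024 / σ := ⟨_, rfl⟩
  obtain ⟨κ, hκ⟩ : ∃ κ, κ = 2 * γ / 1048576 := ⟨_, rfl⟩
  have hγ0 : 0 < γ := by rw [hγ]; positivity
  have hκ0 : 0 < κ := by rw [hκ]; positivity
  have hy0 : 0 < y₁ := by rw [hy₁]; positivity
  have hN0 : 0 < N := by rw [hN]; positivity
  have hκN : κ * N ^ 2 = 2 := by rw [hκ, hN, hγ]; field_simp; norm_num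
  have hκb : κ * b ^ 2 = (2 - 1 / 65536) * 2 / 1048576 := by rw [← hb2, hκ]; ring
  by_contra hcon
  push Not at hcon
  have htop : y₁ + 2 * N < η (min b Λ) := by
    refine lt_of_le_of_lt ?_ hcon
    rw [hy₁, hN]
    have : 1 / (128 * σ) + 2 * (1024 / σ) = (1 / 128 + 2048) / σ := by field_simp; norm_num
    rw [this]; gcongr; norm_num
  have hdom : ∀ x y, -b ≤ x → x ≤ b → y ≤ y₁ + 2 * N → y < η x := by
    intro x y h1 h2 h3
    have := hw.eta_ge_of_abs_le (abs_le.2 ⟨h1, h2⟩)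
    linarith
  have hF : Sm (fun x y => ψ x y - pol (γ / 2 - 2 * κ) κ (y₁ + N) 0 0 0 0 x y) :=
    hw.sm.sub (sm_pol _ _ _ _ _ _ _)
  have hK : IsCompact (Icc (-b) b ×ˢ Icc y₁ (y₁ + 2 * N)) := isCompact_Icc.prod isCompact_Icc
  have hcen : ((0 : ℝ), y₁ + N) ∈ Icc (-b) b ×ˢ Icc y₁ (y₁ + 2 * N) :=
    ⟨⟨by simp only; linarith, hb.le⟩, ⟨by simp only; linarith, by simp only; linarith⟩⟩
  obtain ⟨⟨x', y'⟩, ⟨⟨a1, a2⟩, ⟨a3, a4⟩⟩, hmax⟩ := hK.exists_isMaxOn ⟨_, hcen⟩ hF.cont.continuousOn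
  simp only at a1 a2 a3 a4
  have hmax' : ∀ x y, -b ≤ x → x ≤ b → y₁ ≤ y → y ≤ y₁ + 2 * N →
      ψ x y - pol (γ / 2 - 2 * κ) κ (y₁ + N) 0 0 0 0 x y ≤
      ψ x' y' - pol (γ / 2 - 2 * κ) κ (y₁ + N) 0 0 0 0 x' y' := by
    intro x y b1 b2 b3 b4
    exact hmax (a := (x, y)) ⟨⟨b1, b2⟩, ⟨b3, b4⟩⟩
  have hge : 1 / 65536 ≤ ψ x' y' - pol (γ / 2 - 2 * κ) κ (y₁ + N) 0 0 0 0 x' y' := by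
    refine le_trans ?_ (hmax' 0 (y₁ + N) (by linarith) hb.le (by linarith) (by linarith))
    have := hlow (y₁ + N) (by rw [← hy₁]; linarith)
      (hdom 0 (y₁ + N) (by linarith) hb.le (by linarith)).le
    have e : pol (γ / 2 - 2 * κ) κ (y₁ + N) 0 0 0 0 0 (y₁ + N) = 0 := by unfold pol; ring
    rw [e]; linarith
  have hdy := hdom x' y' a1 a2 a4
  have hle1 := hw.psi_le_one hu (by linarith) hdy.le
  have hp : pol (γ / 2 - 2 * κ) κ (y₁ + N) 0 0 0 0 x' y'
      = (γ / 2 - 2 * κ) * x' ^ 2 + κ * (y' - (y₁ + N)) ^ 2 := by unfold pol; ring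
  have hcoef : 0 ≤ γ / 2 - 2 * κ := by rw [hκ]; linarith
  have t1 : 0 ≤ (γ / 2 - 2 * κ) * x' ^ 2 := by positivity
  have t2 : 0 ≤ κ * (y' - (y₁ + N)) ^ 2 := by positivity
  have side : x' ^ 2 = b ^ 2 → False := by
    intro h
    rw [hp, h] at hge
    have : (γ / 2 - 2 * κ) * b ^ 2 = γ * b ^ 2 / 2 - 2 * (κ * b ^ 2) := by ring
    rw [this, hb2, hκb] at hge
    norm_num at hge
    linarith
  have vert : (y' - (y₁ + N)) ^ 2 = N ^ 2 → False := by
    intro h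
    rw [hp, h, hκN] at hge
    linarith
  rcases a1.lt_or_eq with b1 | b1
  · rcases a2.lt_or_eq with b2 | b2
    · rcases a3.lt_or_eq with b3 | b3
      · rcases a4.lt_or_eq with b4 | b4
        · have hloc : IsLocalMax (fun p : ℝ × ℝ => ψ p.1 p.2 -
              pol (γ / 2 - 2 * κ) κ (y₁ + N) 0 0 0 0 p.1 p.2) (x', y') := by
            have o : Icc (-b) b ×ˢ Icc y₁ (y₁ + 2 * N) ∈ nhds (x', y') :=
              prod_mem_nhds (Icc_mem_nhds b1 b2) (Icc_mem_nhds b3 b4)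
            filter_upwards [o] with p hp
            exact hmax' _ _ hp.1.1 hp.1.2 hp.2.1 hp.2.2
          have := polmax hw.sm hloc
          rw [hw.lap (by linarith) hdy.le] at this
          linarith
        · exact vert (by rw [b4]; ring)
      · exact vert (by rw [← b3]; ring)
    · exact side (by rw [b2])
  · exact side (by rw [← b1]; ring)

set_option maxHeartbeats 800000 in
lemma StokesWave.lemJ (hw : StokesWave γ ψ η r Λ) (hu : Unidirectional ψ η) {σ b : ℝ}
    (hσ : 10000 ≤ σ) (hγ : γ = σ ^ 2) (hb : 0 < b) (hb2 : γ * b ^ 2 = 2 - 1 / 65536)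
    (hr : γ ≤ r) (ha : η (min b Λ) ≤ 2049 / σ) : η 0 ≤ 5121 / σ := by
  have hσ0 : 0 < σ := by linarith
  have hγ0 : 0 < γ := by rw [hγ]; positivity
  obtain ⟨c, hc⟩ : ∃ c, c = min b Λ := ⟨_, rfl⟩
  rw [← hc] at ha
  have hc0 : 0 < c := by rw [hc]; exact lt_min hb hw.lam_pos
  have hcb : c ≤ b := by rw [hc]; exact min_le_left _ _
  have hcx : ∀ x, -c ≤ x → x ≤ c → η c ≤ η x := by
    intro x h1 h2
    have := hw.eta_ge_of_abs_le (b := b) (abs_le.2 ⟨(by linarith : -b ≤ x), (by linarith : x ≤ b)⟩)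
    rw [← hc] at this; exact this
  obtain ⟨l, hl⟩ : ∃ l, l = 3072 / σ := ⟨_, rfl⟩
  obtain ⟨κ, hκ⟩ : ∃ κ, κ = 3 * γ / 9437184 := ⟨_, rfl⟩
  have hκ0 : 0 < κ := by rw [hκ]; positivity
  have hl0 : 0 < l := by rw [hl]; positivity
  have hκl : κ * l ^ 2 = 3 := by rw [hκ, hl, hγ]; field_simp; norm_num
  have hκb : κ * b ^ 2 = (2 - 1 / 65536) * 3 / 9437184 := by rw [← hb2, hκ]; ring
  have hηc := hw.sol.eta_pos c
  by_contra hcon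
  push Not at hcon
  obtain ⟨ym, hym⟩ : ∃ ym, ym = η c + l := ⟨_, rfl⟩
  have hcr : ym < η 0 := by
    refine lt_of_le_of_lt ?_ hcon
    rw [hym, hl]
    have : (5121 : ℝ) / σ = 2049 / σ + 3072 / σ := by ring
    linarith
  have hF : Sm (fun x y => ψ x y - pol (γ / 2 + 2 * κ) (-κ) ym 0 0 0 0 x y) :=
    hw.sm.sub (sm_pol _ _ _ _ _ _ _)
  have hK : IsCompact ((Icc (-c) c ×ˢ Icc (η c) (ym + l)) ∩ {p : ℝ × ℝ | p.2 ≤ η p.1}) := by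
    apply (isCompact_Icc.prod isCompact_Icc).inter_right
    exact isClosed_le continuous_snd (hw.etac.comp continuous_fst)
  have hcen : ((0 : ℝ), ym) ∈ (Icc (-c) c ×ˢ Icc (η c) (ym + l)) ∩ {p : ℝ × ℝ | p.2 ≤ η p.1} :=
    ⟨⟨⟨by simp only; linarith, hc0.le⟩, ⟨by simp only; linarith, by simp only; linarith⟩⟩, hcr.le⟩
  obtain ⟨⟨x', y'⟩, ⟨⟨⟨a1, a2⟩, ⟨a3, a4⟩⟩, a5⟩, hmin⟩ :=
    hK.exists_isMinOn ⟨_, hcen⟩ hF.cont.continuousOn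
  simp only [mem_ofPred_eq] at a1 a2 a3 a4 a5
  have hmin' : ∀ x y, -c ≤ x → x ≤ c → η c ≤ y → y ≤ ym + l → y ≤ η x →
      ψ x' y' - pol (γ / 2 + 2 * κ) (-κ) ym 0 0 0 0 x' y' ≤
      ψ x y - pol (γ / 2 + 2 * κ) (-κ) ym 0 0 0 0 x y := by
    intro x y b1 b2 b3 b4 b5
    exact hmin (a := (x, y)) ⟨⟨⟨b1, b2⟩, ⟨b3, b4⟩⟩, b5⟩
  have hle : ψ x' y' - pol (γ / 2 + 2 * κ) (-κ) ym 0 0 0 0 x' y' ≤ 1 := by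
    refine le_trans (hmin' 0 ym (by linarith) hc0.le (by linarith) (by linarith) hcr.le) ?_
    have e : pol (γ / 2 + 2 * κ) (-κ) ym 0 0 0 0 0 ym = 0 := by unfold pol; ring
    rw [e]
    have := hw.psi_le_one hu (x := 0) (y := ym) (by linarith) hcr.le
    linarith
  have hy'0 : 0 < y' := by linarith
  have hge0 := hw.psi_nonneg hu hy'0.le a5
  have hp : pol (γ / 2 + 2 * κ) (-κ) ym 0 0 0 0 x' y'
      = (γ / 2 + 2 * κ) * x' ^ 2 - κ * (y' - ym) ^ 2 := by unfold pol; ring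
  have hxb : x' ^ 2 ≤ b ^ 2 := sq_le_sq' (by linarith) (by linarith)
  have vert : (y' - ym) ^ 2 = l ^ 2 → False := by
    intro h
    rw [hp, h, hκl] at hle
    have h1 : (γ / 2 + 2 * κ) * x' ^ 2 ≤ (γ / 2 + 2 * κ) * b ^ 2 := by gcongr
    have h2 : (γ / 2 + 2 * κ) * b ^ 2 = γ * b ^ 2 / 2 + 2 * (κ * b ^ 2) := by ring
    rw [h2, hb2, hκb] at h1
    norm_num at h1
    linarith
  have c3 : η c < y' := by
    rcases a3.lt_or_eq with h | h
    · exact h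
    · exact (vert (by rw [← h, hym]; ring)).elim
  have c4 : y' < ym + l := by
    rcases a4.lt_or_eq with h | h
    · exact h
    · exact (vert (by rw [h]; ring)).elim
  have c1 : -c < x' := by
    rcases a1.lt_or_eq with h | h
    · exact h
    · rw [← h, hw.eta_even] at a5; linarith
  have c2 : x' < c := by
    rcases a2.lt_or_eq with h | h
    · exact h
    · rw [h] at a5; linarith
  rcases a5.lt_or_eq with c5 | c5
  · have hloc : IsLocalMin (fun p : ℝ × ℝ => ψ p.1 p.2 -
        pol (γ / 2 + 2 * κ) (-κ) ym 0 0 0 0 p.1 p.2) (x', y') := by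
      have o : Icc (-c) c ×ˢ Icc (η c) (ym + l) ∈ nhds (x', y') :=
        prod_mem_nhds (Icc_mem_nhds c1 c2) (Icc_mem_nhds c3 c4)
      filter_upwards [o, hw.nhds_dom hy'0 c5] with p hp hp2
      exact hmin' _ _ hp.1.1 hp.1.2 hp.2.1 hp.2.2 hp2.2.le
    have := polmin hw.sm hloc
    rw [hw.lap hy'0.le c5.le] at this
    linarith
  · have epx : px (pol (γ / 2 + 2 * κ) (-κ) ym 0 0 0 0) x' y' = _ :=
      (hasx_pol (γ / 2 + 2 * κ) (-κ) ym 0 0 0 0 x' y').deriv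
    have epy : py (pol (γ / 2 + 2 * κ) (-κ) ym 0 0 0 0) x' y' = _ :=
      (hasy_pol (γ / 2 + 2 * κ) (-κ) ym 0 0 0 0 x' y').deriv
    have fy : py (fun x y => ψ x y - pol (γ / 2 + 2 * κ) (-κ) ym 0 0 0 0 x y) x' y' ≤ 0 := by
      apply deriv_left_nonpos (hF.hasy x' y')
      filter_upwards [Ioo_mem_nhdsLT c3] with y hy
      exact hmin' x' y c1.le c2.le hy.1.le (by linarith [hy.2]) (by linarith [hy.2])
    have hcur := hF.curve (hw.etad x')
    have hlocc : IsLocalMin (fun t => ψ t (η t) -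
        pol (γ / 2 + 2 * κ) (-κ) ym 0 0 0 0 t (η t)) x' := by
      have o1 : Icc (-c) c ∈ nhds x' := Icc_mem_nhds c1 c2
      have o2 : ∀ᶠ t in nhds x', η t ∈ Icc (η c) (ym + l) := by
        apply hw.etac.continuousAt.eventually
        rw [← c5]; exact Icc_mem_nhds c3 c4
      filter_upwards [o1, o2] with t h1 h2
      have := hmin' t (η t) h1.1 h1.2 h2.1 h2.2 (le_refl _)
      rw [← c5]; exact this
    have fc := hlocc.hasDerivAt_eq_zero hcur
    have hsurf := hw.sm.curve (hw.etad x')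
    have hone : (fun t => ψ t (η t)) = fun _ => 1 := by funext t; exact hw.sol.surface_val t
    rw [hone] at hsurf
    have hs := hsurf.unique (hasDerivAt_const x' (1 : ℝ))
    have hbern := hw.sol.bernoulli x'
    have hpy := hw.py_nonneg hu hy'0.le a5
    rw [← c5] at fc hs hbern
    rw [py_sub hw.sm (sm_pol _ _ _ _ _ _ _)] at fy fc
    rw [px_sub hw.sm (sm_pol _ _ _ _ _ _ _)] at fc
    beta_reduce at fy fc
    rw [epy] at fy fc
    rw [epx] at fc
    obtain ⟨D, hD⟩ : ∃ D, D = deriv η x' := ⟨_, rfl⟩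
    obtain ⟨u, hu'⟩ : ∃ u, u = px ψ x' y' := ⟨_, rfl⟩
    obtain ⟨v, hv⟩ : ∃ v, v = py ψ x' y' := ⟨_, rfl⟩
    obtain ⟨w, hw'⟩ : ∃ w, w = 2 * κ * (ym - y') := ⟨_, rfl⟩
    rw [← hD, ← hu', ← hv] at fc
    rw [← hD, ← hu', ← hv] at hs
    rw [← hu', ← hv] at hbern
    rw [← hv] at fy hpy
    have f1 : v ≤ w := by rw [hw']; linarith
    have f2 : D * w = -(γ + 4 * κ) * x' := by
      rw [hw']
      linear_combination hs - fc
    have f3 : u = -(D * v) := by linarith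
    have f4 : u ^ 2 ≤ (γ + 4 * κ) ^ 2 * b ^ 2 := by
      have e1 : u ^ 2 = D ^ 2 * v ^ 2 := by rw [f3]; ring
      have e2 : v ^ 2 ≤ w ^ 2 := pow_le_pow_left₀ hpy f1 2
      have e3 : D ^ 2 * v ^ 2 ≤ D ^ 2 * w ^ 2 := by gcongr
      have e4 : D ^ 2 * w ^ 2 = (γ + 4 * κ) ^ 2 * x' ^ 2 := by
        rw [← mul_pow, f2]; ring
      have e5 : (γ + 4 * κ) ^ 2 * x' ^ 2 ≤ (γ + 4 * κ) ^ 2 * b ^ 2 := by gcongr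
      linarith
    have f5 : v ^ 2 ≤ 4 * κ * (κ * l ^ 2) := by
      have e1 : w ≤ 2 * κ * l := by
        rw [hw']; gcongr; linarith
      have e2 : v ^ 2 ≤ (2 * κ * l) ^ 2 := pow_le_pow_left₀ hpy (f1.trans e1) 2
      calc v ^ 2 ≤ (2 * κ * l) ^ 2 := e2
        _ = _ := by ring
    rw [hκl] at f5
    have f6 : (γ + 4 * κ) ^ 2 * b ^ 2
        = γ * (1 + 12 / 9437184) ^ 2 * (γ * b ^ 2) := by rw [hκ]; ring
    rw [f6, hb2] at f4
    have f7 : y' ≤ 8193 / σ := by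
      have : (8193 : ℝ) / σ = 2049 / σ + 2 * (3072 / σ) := by ring
      rw [this, ← hl]; linarith
    have f8 : 8193 / σ ≤ 1 := by rw [div_le_one hσ0]; linarith
    have f9 : (100000000 : ℝ) ≤ γ := by 
      rw [hγ]
      calc (100000000 : ℝ) = 10000 ^ 2 := by norm_num
        _ ≤ σ ^ 2 := pow_le_pow_left₀ (by norm_num) hσ 2
    rw [hκ] at f5
    norm_num at f4 f5
    clear hmin hmin' fc fy hs f1 f2 f3 epx epy
    linarith only [f4, f5, f7, f8, f9, hbern, hr]

end crest


/-! ### Lower bound for the Bernoulli expression and conclusion -/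

section final

variable {γ : ℝ} {ψ : ℝ → ℝ → ℝ} {η : ℝ → ℝ} {r Λ : ℝ}

lemma StokesWave.P_ge (hw : StokesWave γ ψ η r Λ) (hu : Unidirectional ψ η)
    {K : ℝ} (hK : K = η 0 + γ - r) (hK0 : 0 < K) (hK1 : K < γ / 2) {x y : ℝ}
    (h0 : 0 ≤ y) (h1 : y ≤ η x) :
    0 ≤ px ψ x y ^ 2 / 2 + py ψ x y ^ 2 / 2 - γ * ψ x y + K * ψ x y := by
  have hf : ∀ t, HasDerivAt (fun t => K * t) ((fun _ => K) t) t := by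
    intro t
    exact HasDerivAt.congr_deriv ((hasDerivAt_id t).const_mul K) (by simp)
  have hf1 : ∀ t : ℝ, HasDerivAt (fun _ : ℝ => K) ((fun _ : ℝ => (0 : ℝ)) t) t :=
    fun t => hasDerivAt_const t K
  have hfs : ContDiff ℝ (⊤ : ℕ∞) (fun t => K * t) := by fun_prop
  have hQ : Sm (QF γ ψ (fun t => K * t)) := hw.sm.QF hfs
  obtain ⟨x₀, y₀, a0, a1, hmax⟩ := exists_max_periodic (L := 2 * Λ)
    (f := fun x y => - QF γ ψ (fun t => K * t) x y) (by linarith [hw.lam_pos])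
    hQ.neg.cont hw.etac (fun x y => by rw [hw.QF_per]) hw.eta_periodic
    (fun x => (hw.sol.eta_pos x).le)
  have hge : 0 ≤ QF γ ψ (fun t => K * t) x₀ y₀ := by
    rcases a1.lt_or_eq with b1 | b1
    · rcases a0.lt_or_eq with b0 | b0
      · exfalso
        have hloc : IsLocalMin (fun p : ℝ × ℝ => QF γ ψ (fun t => K * t) p.1 p.2) (x₀, y₀) := by
          have := (hw.local_max (Q := fun x y => - QF γ ψ (fun t => K * t) x y) b0 b1 hmax).neg
          simpa using this
        obtain ⟨c1, c2, c3, c4⟩ := locmin hQ hloc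
        have := hw.QF_lap hu hf hf1 b0 b1 c1 c2
        simp only [zero_mul, add_zero] at this
        nlinarith
      · unfold QF
        rw [← b0, hw.px_bot, hw.sol.bottom_val]
        have := sq_nonneg (py ψ x₀ 0)
        linarith
    · unfold QF
      rw [b1, hw.sol.surface_val]
      have := hw.sol.bernoulli x₀
      have := hw.eta_le x₀
      linarith
  have := hmax x y h0 h1
  have h2 : 0 ≤ QF γ ψ (fun t => K * t) x y := by linarith
  exact h2

lemma StokesWave.crest_le (hw : StokesWave γ ψ η r Λ) (hu : Unidirectional ψ η)
    {K : ℝ} (hK : K = η 0 + γ - r) (hK0 : 0 < K) (hK1 : K < γ / 2) :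
    (γ - K) * η 0 ^ 2 ≤ 2 := by
  obtain ⟨m, hm⟩ : ∃ m, m = Real.sqrt ((γ - K) / 2) := ⟨_, rfl⟩
  have hm0 : 0 ≤ m := by rw [hm]; exact Real.sqrt_nonneg _
  have hm2 : m ^ 2 = (γ - K) / 2 := by rw [hm]; exact Real.sq_sqrt (by linarith)
  have hη := hw.sol.eta_pos 0
  have hmono : MonotoneOn (fun y => Real.sqrt (ψ 0 y) - m * y) (Icc 0 (η 0)) := by
    have hc := hw.sm.conty 0
    have hd : ∀ y ∈ Ioo 0 (η 0), HasDerivAt (fun y => Real.sqrt (ψ 0 y) - m * y)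
        (py ψ 0 y / (2 * Real.sqrt (ψ 0 y)) - m * 1) y := by
      intro y hy
      exact ((hw.sm.hasy 0 y).sqrt (hw.psi_pos hu hy.1 hy.2.le).ne').sub
        ((hasDerivAt_id y).const_mul m)
    apply monotoneOn_of_deriv_nonneg (convex_Icc _ _)
    · exact Continuous.continuousOn (by fun_prop)
    · intro y hy
      rw [interior_Icc] at hy
      exact (hd y hy).differentiableAt.differentiableWithinAt
    · intro y hy
      rw [interior_Icc] at hy
      rw [(hd y hy).deriv]
      have hp := hw.psi_pos hu hy.1 hy.2.le
      have h2 : 0 < Real.sqrt (ψ 0 y) := Real.sqrt_pos.2 hp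
      have h3 := hw.P_ge hu hK hK0 hK1 hy.1.le hy.2.le
      rw [hw.px_crest] at h3
      have h4 : (2 * m * Real.sqrt (ψ 0 y)) ^ 2 ≤ py ψ 0 y ^ 2 := by
        rw [mul_pow, mul_pow, hm2, Real.sq_sqrt hp.le]
        linarith
      have h5 : 2 * m * Real.sqrt (ψ 0 y) ≤ py ψ 0 y :=
        (pow_le_pow_iff_left₀ (by positivity) (hw.py_nonneg hu hy.1.le hy.2.le) two_ne_zero).1 h4
      have h6 : m ≤ py ψ 0 y / (2 * Real.sqrt (ψ 0 y)) := by
        rw [le_div_iff₀ (by positivity)]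
        linarith
      linarith
  have h1 := hmono ⟨le_refl 0, hη.le⟩ ⟨hη.le, le_refl _⟩ hη.le
  simp only [hw.sol.surface_val, hw.sol.bottom_val, Real.sqrt_zero, Real.sqrt_one, mul_zero,
    sub_zero] at h1
  have h2 : (m * η 0) ^ 2 ≤ 1 ^ 2 := pow_le_pow_left₀ (by positivity) (by linarith) 2
  rw [mul_pow, hm2] at h2
  linarith

lemma StokesWave.amplitude {sc : ℝ} (hγ : 100000000 < γ) (hw : StokesWave γ ψ η r Λ)
    (hu : Unidirectional ψ η) (hc : IsCrit γ sc) (hr1 : bernR γ sc < r) (hr2 : r ≤ bernR γ 0) :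
    η 0 - η Λ ≤ 4 / γ ^ 2 := by
  have hγ0 : 0 < γ := by linarith
  obtain ⟨σ, hσ⟩ : ∃ σ, σ = Real.sqrt γ := ⟨_, rfl⟩
  have hσγ : γ = σ ^ 2 := by rw [hσ]; exact (Real.sq_sqrt hγ0.le).symm
  have hσ4 : 10000 ≤ σ := by
    rw [hσ]; apply Real.le_sqrt_of_sq_le; linarith
  have hσ0 : 0 < σ := by linarith
  obtain ⟨d, hd⟩ : ∃ d, d = Real.sqrt (2 * γ) / γ := ⟨_, rfl⟩
  have hd0 : 0 < d := by rw [hd]; positivity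
  have hd2 : γ * d ^ 2 = 2 := by
    rw [hd, div_pow, Real.sq_sqrt (by positivity)]; field_simp
  have hrd : r ≤ γ + d := by
    unfold bernR lamDepth at hr2
    have : (-(0 : ℝ) + Real.sqrt (0 ^ 2 + 2 * γ)) / γ = d := by rw [hd]; simp
    rw [this] at hr2
    linarith
  have hrl := crit_bound hγ0 hd hc hr1
  have htr := hw.trough_ge hu hγ0 hd0 hd2 hrd
  have hgsm : 1 / γ ^ 2 ≤ 1 / 10 / σ := by
    rw [hσγ, div_div]
    apply one_div_le_one_div_of_le (by positivity)
    have : (10000 : ℝ) ^ 3 ≤ σ ^ 3 := pow_le_pow_left₀ (by norm_num) hσ4 3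
    have : 10 * σ ≤ σ ^ 3 * σ := by gcongr; linarith
    linarith [show (σ ^ 2) ^ 2 = σ ^ 3 * σ by ring]
  have h2g : 2 / γ ^ 2 = 2 * (1 / γ ^ 2) := by ring
  have h4g : 4 / γ ^ 2 = 4 * (1 / γ ^ 2) := by ring
  have hg0 : 0 < 1 / γ ^ 2 := by positivity
  obtain ⟨i, hi⟩ : ∃ i, i = 1 / σ := ⟨_, rfl⟩
  have hi0 : 0 < i := by rw [hi]; positivity
  have hi1 : i ≤ 1 / 10000 := by
    rw [hi]; exact one_div_le_one_div_of_le (by norm_num) hσ4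
  have hgi : 1 / γ ^ 2 ≤ 1 / 10 * i := by
    rw [hi]; calc _ ≤ _ := hgsm
      _ = _ := by ring
  have hdi : d ^ 2 = 2 * i ^ 2 := by
    have : d ^ 2 = 2 / γ := by field_simp; linarith
    rw [this, hi, hσγ]; field_simp
  have hd_lo : 7 / 5 * i ≤ d := by
    apply (pow_le_pow_iff_left₀ (by positivity) hd0.le two_ne_zero).1
    rw [hdi]; nlinarith
  have hd_hi : d ≤ 2 * i := by
    apply (pow_le_pow_iff_left₀ hd0.le (by positivity) two_ne_zero).1
    rw [hdi]; nlinarith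
  have hrg : γ ≤ r := by linarith
  have hHη : ∀ x, 1 / σ ≤ η x := by
    intro x
    have := hw.eta_ge x
    rw [← hi]; linarith
  have hb : ∀ x y, 0 ≤ y → y ≤ η x → px ψ x y ≤ 2 * σ := by
    intro x y h0 h1
    have hT : ∀ x, r - γ - η x ≤ 2 / γ ^ 2 := fun x => by linarith [hw.eta_ge x]
    have hP := hw.P_le hu hγ0 (by positivity) hT h0 h1
    have h2 := hw.psi_le_one hu h0 h1
    have h3 : γ * ψ x y ≤ γ * 1 := by gcongr
    have h4 := sq_nonneg (py ψ x y)
    have h5 : px ψ x y ^ 2 ≤ (2 * σ) ^ 2 := by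
      rw [mul_pow, ← hσγ]; linarith
    exact (abs_le_of_sq_le_sq' h5 (by positivity)).2
  obtain ⟨b, hbd⟩ : ∃ b, b = Real.sqrt ((2 - 1 / 65536) / γ) := ⟨_, rfl⟩
  have hb0 : 0 < b := by
    rw [hbd]; apply Real.sqrt_pos.2; apply div_pos _ hγ0; norm_num
  have hb2 : γ * b ^ 2 = 2 - 1 / 65536 := by
    rw [hbd, Real.sq_sqrt (div_nonneg (by norm_num) hγ0.le)]; field_simp
  have hR := hw.lemR hu hσ0 hσγ hb0 hb2 (fun y h0 h1 => hw.psi_low hu hσ0 hσγ hHη hb h0 h1)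
  have hJ := hw.lemJ hu hσ4 hσγ hb0 hb2 hrg hR
  have hJ' : η 0 ≤ 1 := by
    have : 5121 / σ = 5121 * i := by rw [hi]; ring
    linarith
  obtain ⟨K, hK⟩ : ∃ K, K = η 0 + γ - r := ⟨_, rfl⟩
  have hKle : K ≤ 2 / γ ^ 2 := by
    by_contra hcon
    push Not at hcon
    have hK0 : 0 < K := by linarith
    have hK1 : K ≤ 1 := by linarith
    have hcl := hw.crest_le hu hK hK0 (by linarith)
    have h1 : d + K / 2 ≤ η 0 := by linarith
    have h2 : (d + K / 2) ^ 2 ≤ η 0 ^ 2 := pow_le_pow_left₀ (by positivity) h1 2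
    have h3 : d ^ 2 + d * K ≤ η 0 ^ 2 := by nlinarith [sq_nonneg K]
    have h4 : (γ - K) * (d ^ 2 + d * K) ≤ (γ - K) * η 0 ^ 2 := by
      apply mul_le_mul_of_nonneg_left h3; linarith
    have h5 : d * K * (γ - d - K) ≤ 0 := by
      have : d * K * (γ - d - K) = (γ - K) * (d ^ 2 + d * K) - γ * d ^ 2 := by ring
      linarith
    have h6 : 0 < d * K * (γ - d - K) := by
      apply mul_pos (mul_pos hd0 hK0); linarith
    linarith
  linarith

end final

/-- Theorem 1.1 (iii): Stokes waves with large adverse vorticity have small amplitude,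
`η̂ - η̌ ≤ C γ⁻²`. -/
theorem small_amplitude :
    ∃ C > (0 : ℝ), ∃ γ₀ > (0 : ℝ), ∀ γ > γ₀,
      ∀ (ψ : ℝ → ℝ → ℝ) (η : ℝ → ℝ) (r Λ sc : ℝ),
        StokesWave γ ψ η r Λ → Unidirectional ψ η → IsCrit γ sc →
        bernR γ sc < r → r ≤ bernR γ 0 →
        η 0 - η Λ ≤ C / γ ^ 2 := by
  refine ⟨4, by norm_num, 100000000, by norm_num, ?_⟩
  intro γ hγ ψ η r Λ sc hw hu hc h1 h2
  exact StokesWave.amplitude hγ hw hu hc h1 h2
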